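/- Let X be a compact Ptolemy space with properties (E) and (I), and let ω ∈ X. Define the distance between two fibers F, F' of the canonical fibration π_ω by dist(F,F') = inf{d(x,x') : x ∈ F, x' ∈ F'}. Then: (1) dist is a metric on the set B_ω of fibers and dist(F,F') = d(x,x') whenever x ∈ F and x' ∈ F' lie on a common Ptolemy line; (2) π_ω : X_ω → B_ω is a 1-Lipschitz submetry, i.e. it is 1-Lipschitz and maps every ball of radius r in X_ω onto the ball of the same radius r centered at the image point; (3) (B_ω, dist) is isometric to a Euclidean space ℝᵏ for some integer k ≥ 1. -/

import Mathlib

open scoped ENNReal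

namespace Mobius

/-- An extended metric on `X`, allowed to have (at most) one infinitely remote point,
which is recorded in the field `rem`.  Distances take values in `ℝ≥0∞`, and the value `⊤`
occurs exactly on pairs of distinct points one of which is the remote point. -/
structure ExtMetric (X : Type*) where
  d : X → X → ℝ≥0∞
  rem : Option X
  symm : ∀ x y, d x y = d y x
  d_self : ∀ x, d x x = 0
  pos : ∀ x y, x ≠ y → 0 < d x y
  triangle : ∀ x y z, d x z ≤ d x y + d y z
  d_eq_top_iff : ∀ x y, d x y = ⊤ ↔ (x ≠ y ∧ (rem = some x ∨ rem = some y))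

/-- The finite factor of a distance used in cross-ratio triples: infinite factors are
dropped (replaced by `1`), in accordance with the standard conventions for cross-ratio
triples of quadruples containing the infinitely remote point. -/
noncomputable def ExtMetric.fd {X : Type*} (d : ExtMetric X) (x y : X) : ℝ :=
  if d.d x y = ⊤ then 1 else (d.d x y).toReal

/-- A representative in `ℝ³` of the cross-ratio triple
`crt(x,y,z,u) = (d(x,y)d(z,u) : d(x,z)d(y,u) : d(x,u)d(y,z)) ∈ ℝP²`,
with the standard conventions when the infinitely remote point occurs among the points. -/
noncomputable def crtVec {X : Type*} (d : ExtMetric X) (x y z u : X) : ℝ × ℝ × ℝ :=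
  (d.fd x y * d.fd z u, d.fd x z * d.fd y u, d.fd x u * d.fd y z)

/-- A quadruple is admissible if no entry occurs three or four times in it. -/
def Admissible {X : Type*} (x y z u : X) : Prop :=
  ¬(x = y ∧ y = z) ∧ ¬(x = y ∧ y = u) ∧ ¬(x = z ∧ z = u) ∧ ¬(y = z ∧ z = u)

/-- Two vectors in `ℝ³` represent the same point of the projective plane (they are
positively proportional). -/
def ProjEq (v w : ℝ × ℝ × ℝ) : Prop :=
  ∃ lam : ℝ, 0 < lam ∧ w = lam • v

theorem ProjEq.refl (v : ℝ × ℝ × ℝ) : ProjEq v v :=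
  ⟨1, one_pos, (one_smul ℝ v).symm⟩

theorem ProjEq.symm {v w : ℝ × ℝ × ℝ} (h : ProjEq v w) : ProjEq w v := by
  obtain ⟨l, hl, rfl⟩ := h
  exact ⟨l⁻¹, inv_pos.mpr hl, by rw [smul_smul, inv_mul_cancel₀ hl.ne', one_smul]⟩

theorem ProjEq.trans' {v w u : ℝ × ℝ × ℝ} (h1 : ProjEq v w) (h2 : ProjEq v u) :
    ProjEq w u := by
  obtain ⟨l, hl, rfl⟩ := h1
  obtain ⟨m, hm, rfl⟩ := h2
  refine ⟨m * l⁻¹, by positivity, ?_⟩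
  rw [smul_smul, mul_assoc, inv_mul_cancel₀ hl.ne', mul_one]

/-- A Möbius structure on a set `X`: a (maximal) class of pairwise Möbius-equivalent
extended metrics on `X`, i.e. metrics defining the same cross-ratio triples on all
admissible quadruples. -/
structure MobiusStructure (X : Type*) where
  M : Set (ExtMetric X)
  nonempty : M.Nonempty
  compat : ∀ d ∈ M, ∀ d' ∈ M, ∀ x y z u : X, Admissible x y z u →
    ProjEq (crtVec d x y z u) (crtVec d' x y z u)
  maximal : ∀ d' : ExtMetric X,
    (∀ d ∈ M, ∀ x y z u : X, Admissible x y z u →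
      ProjEq (crtVec d x y z u) (crtVec d' x y z u)) → d' ∈ M

/-- The Möbius structure generated by a single extended metric. -/
def MobiusStructure.ofMetric {X : Type*} (d₀ : ExtMetric X) : MobiusStructure X where
  M := {d | ∀ x y z u : X, Admissible x y z u →
    ProjEq (crtVec d₀ x y z u) (crtVec d x y z u)}
  nonempty := ⟨d₀, fun _ _ _ _ _ => ProjEq.refl _⟩
  compat := fun _ hd _ hd' x y z u ha => (hd x y z u ha).trans' (hd' x y z u ha)
  maximal := fun _ h => h d₀ (fun _ _ _ _ _ => ProjEq.refl _)

/-- A Möbius structure is Ptolemy if the entries of every cross-ratio triple of every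
admissible quadruple satisfy the triangle inequality. -/
def IsPtolemyStructure {X : Type*} (S : MobiusStructure X) : Prop :=
  ∀ d ∈ S.M, ∀ x y z u : X, Admissible x y z u →
    (crtVec d x y z u).1 ≤ (crtVec d x y z u).2.1 + (crtVec d x y z u).2.2 ∧
    (crtVec d x y z u).2.1 ≤ (crtVec d x y z u).1 + (crtVec d x y z u).2.2 ∧
    (crtVec d x y z u).2.2 ≤ (crtVec d x y z u).1 + (crtVec d x y z u).2.1

/-- The topology of a Möbius space: generated by the open balls of the metrics of the
structure (centered at points distinct from the respective remote points) together with
the complements of the closed balls. -/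
def mobiusTop {X : Type*} (S : MobiusStructure X) : TopologicalSpace X :=
  TopologicalSpace.generateFrom
    {s | ∃ d ∈ S.M, ∃ x : X, d.rem ≠ some x ∧ ∃ r : ℝ≥0∞, 0 < r ∧ r ≠ ⊤ ∧
      (s = {y | d.d y x < r} ∨ s = {y | r < d.d y x})}

/-- Connected components of subsets with respect to the Möbius topology. -/
def mobiusCCIn {X : Type*} (S : MobiusStructure X) (F : Set X) (x : X) : Set X :=
  @connectedComponentIn X (mobiusTop S) F x

/-- The pair `(x,z)` separates the pair `(y,u)` in `σ`:  `y` and `u` lie in different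
connected components of `σ \ {x,z}`. -/
def SeparatesIn {X : Type*} (S : MobiusStructure X) (σ : Set X) (x z y u : X) : Prop :=
  u ∉ mobiusCCIn S (σ \ {x, z}) y

/-- `σ` is homeomorphic to the circle `S¹` (with respect to the Möbius topology). -/
def HomeoToCircle {X : Type*} (S : MobiusStructure X) (σ : Set X) : Prop :=
  letI : TopologicalSpace X := mobiusTop S
  Nonempty (σ ≃ₜ Metric.sphere (0 : ℂ) 1)

/-- `X` is homeomorphic to the sphere `Sⁿ ⊆ ℝ^{n+1}` (w.r.t. the Möbius topology). -/
def HomeoToSphere {X : Type*} (S : MobiusStructure X) (n : ℕ) : Prop :=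
  letI : TopologicalSpace X := mobiusTop S
  Nonempty (X ≃ₜ Metric.sphere (0 : EuclideanSpace ℝ (Fin (n + 1))) 1)

/-- The subset `A ⊆ X` is homeomorphic to `ℝᵖ` (w.r.t. the Möbius topology). -/
def SubsetHomeoToEuclidean {X : Type*} (S : MobiusStructure X) (A : Set X) (p : ℕ) : Prop :=
  letI : TopologicalSpace X := mobiusTop S
  Nonempty (A ≃ₜ EuclideanSpace ℝ (Fin p))

/-- The subset `A ⊆ X` is homeomorphic to `ℝ` (w.r.t. the Möbius topology). -/
def SubsetHomeoToReal {X : Type*} (S : MobiusStructure X) (A : Set X) : Prop :=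
  letI : TopologicalSpace X := mobiusTop S
  Nonempty (A ≃ₜ ℝ)

/-- A Ptolemy circle: a subset homeomorphic to `S¹` on which the Ptolemy equality holds
for every quadruple of distinct points `(x,y,z,u)` such that `(x,z)` separates `(y,u)`. -/
def IsPtolemyCircle {X : Type*} (S : MobiusStructure X) (σ : Set X) : Prop :=
  HomeoToCircle S σ ∧
  ∀ d ∈ S.M, ∀ x ∈ σ, ∀ y ∈ σ, ∀ z ∈ σ, ∀ u ∈ σ,
    x ≠ y → x ≠ z → x ≠ u → y ≠ z → y ≠ u → z ≠ u →
    SeparatesIn S σ x z y u →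
    d.d x z * d.d y u = d.d x y * d.d z u + d.d x u * d.d y z

/-- A Möbius automorphism of `X`: a bijection preserving all cross-ratio triples. -/
def IsMobiusAuto {X : Type*} (S : MobiusStructure X) (f : X → X) : Prop :=
  Function.Bijective f ∧ ∀ d ∈ S.M, ∀ x y z u : X, Admissible x y z u →
    ProjEq (crtVec d x y z u) (crtVec d (f x) (f y) (f z) (f u))

/-- A metric sphere between two distinct points `ω`, `ω'`. -/
def IsMetricSphere {X : Type*} (S : MobiusStructure X) (ω ω' : X) (Sp : Set X) : Prop :=
  ∃ d ∈ S.M, d.rem = some ω' ∧ ∃ r : ℝ≥0∞, 0 < r ∧ r ≠ ⊤ ∧ Sp = {x | d.d x ω = r}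

/-- A space inversion with respect to `ω`, `ω'` and a metric sphere `Sp` between them. -/
def IsSpaceInversion {X : Type*} (S : MobiusStructure X) (ω ω' : X) (Sp : Set X)
    (φ : X → X) : Prop :=
  IsMobiusAuto S φ ∧ Function.Involutive φ ∧ (∀ x, φ x ≠ x) ∧ φ ω = ω' ∧
  φ '' Sp = Sp ∧ ∀ σ : Set X, IsPtolemyCircle S σ → ω ∈ σ → ω' ∈ σ → φ '' σ = σ

/-- Property (E): existence of at least one Ptolemy circle. -/
def PropertyE {X : Type*} (S : MobiusStructure X) : Prop :=
  ∃ σ : Set X, IsPtolemyCircle S σ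

/-- Property (I): existence and uniqueness of space inversions. -/
def PropertyI {X : Type*} (S : MobiusStructure X) : Prop :=
  ∀ ω ω' : X, ω ≠ ω' → ∀ Sp : Set X, IsMetricSphere S ω ω' Sp →
    ∃! φ : X → X, IsSpaceInversion S ω ω' Sp φ

/-- The Möbius space is compact. -/
def MobiusCompact {X : Type*} (S : MobiusStructure X) : Prop :=
  letI : TopologicalSpace X := mobiusTop S
  CompactSpace X

/-- Property (H), the homothety property. -/
def PropertyH {X : Type*} (S : MobiusStructure X) : Prop :=
  ∀ ω ω' : X, ω ≠ ω' → ∀ σ : Set X, IsPtolemyCircle S σ → ω ∈ σ → ω' ∈ σ →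
    ∀ x x' : X, x ∈ σ \ {ω, ω'} → x' ∈ mobiusCCIn S (σ \ {ω, ω'}) x →
    ∃ γ : X → X, IsMobiusAuto S γ ∧ γ ω = ω ∧ γ ω' = ω' ∧
      (∀ σ' : Set X, IsPtolemyCircle S σ' → ω ∈ σ' → ω' ∈ σ' →
        γ '' σ' = σ' ∧ ∀ y ∈ σ' \ {ω, ω'}, γ y ∈ mobiusCCIn S (σ' \ {ω, ω'}) y) ∧
      γ x = x'

/-- A Ptolemy line in `X_ω`: a Ptolemy circle through `ω` with `ω` removed. -/
def IsPtolemyLine {X : Type*} (S : MobiusStructure X) (ω : X) (l : Set X) : Prop :=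
  ∃ σ : Set X, IsPtolemyCircle S σ ∧ ω ∈ σ ∧ l = σ \ {ω}

/-- `c : ℝ → X` is a unit-speed parameterization of `l ⊆ X` w.r.t. the metric `d`. -/
def IsUnitSpeed {X : Type*} (d : ExtMetric X) (l : Set X) (c : ℝ → X) : Prop :=
  Set.range c = l ∧ ∀ s t : ℝ, d.d (c s) (c t) = ENNReal.ofReal |s - t|

/-- `b` is a Busemann function of the Ptolemy line `l ⊆ X_ω`:  up to an additive constant,
`b x = lim_{t→∞} (d(x,c(t)) − t)` for a unit-speed parameterization `c` of `l`. -/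
def IsBusemannOf {X : Type*} (S : MobiusStructure X) (d : ExtMetric X) (ω : X)
    (l : Set X) (b : X → ℝ) : Prop :=
  IsPtolemyLine S ω l ∧ ∃ c : ℝ → X, IsUnitSpeed d l c ∧ ∃ C : ℝ, ∀ x : X, x ≠ ω →
    Filter.Tendsto (fun t => (d.d x (c t)).toReal - t) Filter.atTop (nhds (b x + C))

/-- The fiber through `x` of the canonical fibration `π_ω`: the set of points on which
every Busemann function of every Ptolemy line of `X_ω` takes the same value as at `x`. -/
def mobiusFiber {X : Type*} (S : MobiusStructure X) (d : ExtMetric X) (ω : X) (x : X) :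
    Set X :=
  {y | y ≠ ω ∧ ∀ (l : Set X) (b : X → ℝ), IsBusemannOf S d ω l b → b y = b x}

/-- The base `B_ω` of the canonical fibration: the set of all fibers. -/
def mobiusBase {X : Type*} (S : MobiusStructure X) (d : ExtMetric X) (ω : X) :
    Set (Set X) :=
  {F | ∃ x : X, x ≠ ω ∧ F = mobiusFiber S d ω x}

/-- The distance between two fibers. -/
noncomputable def fiberDist {X : Type*} (d : ExtMetric X) (F F' : Set X) : ℝ :=
  sInf {r : ℝ | ∃ x ∈ F, ∃ x' ∈ F', r = (d.d x x').toReal}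

/-- Two Möbius spaces are Möbius equivalent: there is a bijection between them
preserving all cross-ratio triples. -/
def MobiusEquiv {X Y : Type*} (S : MobiusStructure X) (S' : MobiusStructure Y) : Prop :=
  ∃ f : X → Y, Function.Bijective f ∧ ∀ d ∈ S.M, ∀ d' ∈ S'.M, ∀ x y z u : X,
    Admissible x y z u → ProjEq (crtVec d x y z u) (crtVec d' (f x) (f y) (f z) (f u))

/-- The standard extended Euclidean metric on the one-point extension
`ℝ̂ⁿ = ℝⁿ ∪ {∞}`, where `∞` is encoded by `none`. -/
noncomputable def stdExtMetric (n : ℕ) : ExtMetric (Option (EuclideanSpace ℝ (Fin n))) where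
  d x y :=
    match x, y with
    | none, none => 0
    | none, some _ => ⊤
    | some _, none => ⊤
    | some a, some b => ENNReal.ofReal (dist a b)
  rem := some none
  symm := by intro x y; cases x <;> cases y <;> simp [dist_comm]
  d_self := by intro x; cases x <;> simp
  pos := by
    intro x y h
    cases x <;> cases y
    · exact absurd rfl h
    · simp
    · simp
    · simp only [ne_eq, Option.some.injEq] at h
      exact ENNReal.ofReal_pos.mpr (dist_pos.mpr h)
  triangle := by
    intro x y z
    cases x <;> cases y <;> cases z <;>
      simp only [le_refl, le_top, zero_le, zero_add, add_zero, top_add, add_top,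
        top_le_iff]
    rw [← ENNReal.ofReal_add dist_nonneg dist_nonneg]
    exact ENNReal.ofReal_le_ofReal (dist_triangle _ _ _)
  d_eq_top_iff := by
    intro x y
    cases x <;> cases y <;>
      simp [ENNReal.ofReal_ne_top]


section FibrationProof

open Filter Topology

/-- The metric features of `X_ω` for a Ptolemy space with properties (E) and (I): the Ptolemy
inequality, the existence of a geodesic line, and inversions in all nonempty spheres which act
on the geodesic lines through the center by `t ↦ -r² / t`. -/
structure IsInversive (Y : Type*) [MetricSpace Y] : Prop where
  ptolemy : ∀ x y z u : Y, dist x z * dist y u ≤ dist x y * dist z u + dist x u * dist y z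
  exists_line : ∃ c : ℝ → Y, Isometry c
  exists_inversion : ∀ (x : Y) (r : ℝ), 0 < r → (∃ y, dist y x = r) → ∃ φ : Y → Y,
    (∀ y, y ≠ x → φ y ≠ x ∧ φ (φ y) = y) ∧
    (∀ y z, y ≠ x → z ≠ x → dist (φ y) (φ z) = r ^ 2 * dist y z / (dist y x * dist z x)) ∧
    (∀ y, y ≠ x → dist (φ y) x = r ^ 2 / dist y x) ∧
    ∀ c : ℝ → Y, Isometry c → c 0 = x → ∀ t, t ≠ 0 → φ (c t) = c (-(r ^ 2 / t))

section Busemann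

variable {Y : Type*} [MetricSpace Y]

theorem dist_line {c : ℝ → Y} (hc : Isometry c) (s t : ℝ) : dist (c s) (c t) = |s - t| := by
  rw [hc.dist_eq, Real.dist_eq]

theorem isometry_of_dist {c : ℝ → Y} (h : ∀ s t, dist (c s) (c t) = |s - t|) : Isometry c :=
  Isometry.of_dist_eq fun s t => by rw [h, Real.dist_eq]

theorem isometry_reverse {c : ℝ → Y} (hc : Isometry c) : Isometry fun t => c (-t) :=
  isometry_of_dist fun s t => by
    rw [dist_line hc, ← abs_neg]; congr 1; ring

theorem isometry_translate {c : ℝ → Y} (hc : Isometry c) (a : ℝ) : Isometry fun t => c (a + t) :=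
  isometry_of_dist fun s t => by
    rw [dist_line hc]; congr 1; ring

/-- The Busemann function of the geodesic line `c`. -/
noncomputable def busemann (c : ℝ → Y) (x : Y) : ℝ :=
  limUnder atTop fun t => dist x (c t) - t

theorem tendsto_busemann {c : ℝ → Y} (hc : Isometry c) (x : Y) :
    Tendsto (fun t => dist x (c t) - t) atTop (𝓝 (busemann c x)) := by
  have hanti : Antitone fun t => dist x (c t) - t := by
    intro s t hst
    have h1 := dist_triangle x (c s) (c t)
    have h2 := dist_line hc s t
    rw [abs_sub_comm, abs_of_nonneg (sub_nonneg.2 hst)] at h2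
    simp only
    linarith
  have hbdd : BddBelow (Set.range fun t => dist x (c t) - t) := by
    refine ⟨-dist x (c 0), ?_⟩
    rintro _ ⟨t, rfl⟩
    have h1 := dist_triangle (c 0) x (c t)
    have h2 := dist_line hc 0 t
    rw [zero_sub, abs_neg] at h2
    have h3 := le_abs_self t
    rw [dist_comm (c 0) x] at h1
    simp only
    linarith
  exact tendsto_nhds_limUnder ⟨_, tendsto_atTop_ciInf hanti hbdd⟩

theorem busemann_eq {c : ℝ → Y} (hc : Isometry c) {x : Y} {a : ℝ}
    (h : Tendsto (fun t => dist x (c t) - t) atTop (𝓝 a)) : busemann c x = a :=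
  tendsto_nhds_unique (tendsto_busemann hc x) h

theorem busemann_le {c : ℝ → Y} (hc : Isometry c) (x y : Y) :
    busemann c x ≤ busemann c y + dist x y := by
  refine le_of_tendsto_of_tendsto (tendsto_busemann hc x)
    ((tendsto_busemann hc y).add_const (dist x y)) (Eventually.of_forall fun t => ?_)
  have := dist_triangle x y (c t)
  simp only
  linarith

theorem abs_busemann_sub_le {c : ℝ → Y} (hc : Isometry c) (x y : Y) :
    |busemann c x - busemann c y| ≤ dist x y := by
  rw [abs_sub_le_iff]
  have h1 := busemann_le hc x y
  have h2 := busemann_le hc y x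
  rw [dist_comm y x] at h2
  constructor <;> linarith

theorem continuous_busemann {c : ℝ → Y} (hc : Isometry c) : Continuous (busemann c) :=
  (LipschitzWith.of_dist_le_mul (K := 1) fun x y => by
    simpa [Real.dist_eq] using abs_busemann_sub_le hc x y).continuous

theorem lipschitzWith_dist_line {c : ℝ → Y} (hc : Isometry c) (x : Y) :
    LipschitzWith 1 fun s => dist x (c s) :=
  LipschitzWith.of_dist_le_mul fun s t => by
    rw [Real.dist_eq, NNReal.coe_one, one_mul, ← hc.dist_eq s t, dist_comm x, dist_comm x]
    exact abs_dist_sub_le (c s) (c t) x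

theorem busemann_line {c : ℝ → Y} (hc : Isometry c) (s : ℝ) : busemann c (c s) = -s := by
  refine busemann_eq hc (tendsto_const_nhds.congr' ?_)
  filter_upwards [eventually_ge_atTop s] with t ht
  rw [dist_line hc, abs_sub_comm, abs_of_nonneg (sub_nonneg.2 ht)]
  ring

theorem busemann_zero {c : ℝ → Y} (hc : Isometry c) : busemann c (c 0) = 0 := by
  simpa using busemann_line hc 0

theorem busemann_reverse_line {c : ℝ → Y} (hc : Isometry c) (s : ℝ) :
    busemann (fun t => c (-t)) (c s) = s := by
  simpa using busemann_line (isometry_reverse hc) (-s)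

/-- Distances to points are convex along geodesic lines. -/
theorem IsInversive.dist_line_convex (hY : IsInversive Y) {e : ℝ → Y} (he : Isometry e) (x : Y)
    {u v w : ℝ} (huv : u ≤ v) (hvw : v ≤ w) :
    (w - u) * dist x (e v) ≤ (w - v) * dist x (e u) + (v - u) * dist x (e w) := by
  have h := hY.ptolemy (e u) (e v) (e w) x
  rw [dist_line he u w, dist_line he u v, dist_line he v w, abs_sub_comm u w, abs_sub_comm u v,
    abs_sub_comm v w, abs_of_nonneg (by linarith), abs_of_nonneg (by linarith),
    abs_of_nonneg (by linarith), dist_comm (e v), dist_comm (e w), dist_comm (e u)] at h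
  linarith

theorem IsInversive.busemann_convex (hY : IsInversive Y) {c e : ℝ → Y} (hc : Isometry c)
    (he : Isometry e) {u v w : ℝ} (huv : u ≤ v) (hvw : v ≤ w) :
    (w - u) * busemann c (e v) ≤ (w - v) * busemann c (e u) + (v - u) * busemann c (e w) := by
  refine le_of_tendsto_of_tendsto ((tendsto_busemann hc (e v)).const_mul (w - u))
    (((tendsto_busemann hc (e u)).const_mul (w - v)).add
      ((tendsto_busemann hc (e w)).const_mul (v - u))) (Eventually.of_forall fun t => ?_)
  have h := hY.dist_line_convex he (c t) huv hvw
  rw [dist_comm (c t), dist_comm (c t), dist_comm (c t)] at h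
  simp only
  linarith

end Busemann

section Homothety

variable {Y : Type*} [MetricSpace Y]

/-- Homotheties with center `x` acting in the expected way on all geodesic lines through `x`. -/
def IsHomothety (x : Y) (k : ℝ) (γ : Y ≃ Y) : Prop :=
  0 < k ∧ γ x = x ∧ (∀ y z, dist (γ y) (γ z) = k * dist y z) ∧
    ∀ c : ℝ → Y, Isometry c → c 0 = x → ∀ t, γ (c t) = c (k * t)

theorem IsHomothety.symm {x : Y} {k : ℝ} {γ : Y ≃ Y} (h : IsHomothety x k γ) :
    IsHomothety x k⁻¹ γ.symm := by
  obtain ⟨hk, hx, hd, hl⟩ := h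
  refine ⟨inv_pos.2 hk, by rw [Equiv.symm_apply_eq, hx], fun y z => ?_, fun c hc hc0 t => ?_⟩
  · have := hd (γ.symm y) (γ.symm z)
    rw [Equiv.apply_symm_apply, Equiv.apply_symm_apply] at this
    rw [this, inv_mul_cancel_left₀ hk.ne']
  · rw [Equiv.symm_apply_eq, hl c hc hc0, mul_inv_cancel_left₀ hk.ne']

theorem IsHomothety.pow {x : Y} {k : ℝ} {γ : Equiv.Perm Y} (h : IsHomothety x k γ) (n : ℕ) :
    IsHomothety x (k ^ n) (γ ^ n) := by
  induction n with
  | zero => exact ⟨by simp, by simp, by simp, by simp⟩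
  | succ n ih =>
    obtain ⟨hk, hx, hd, hl⟩ := h
    obtain ⟨hk', hx', hd', hl'⟩ := ih
    refine ⟨by positivity, ?_, fun y z => ?_, fun c hc hc0 t => ?_⟩
    · rw [pow_succ, Equiv.Perm.mul_apply, hx, hx']
    · rw [pow_succ, Equiv.Perm.mul_apply, Equiv.Perm.mul_apply, hd', hd, pow_succ, mul_assoc]
    · rw [pow_succ, Equiv.Perm.mul_apply, hl c hc hc0, hl' c hc hc0, pow_succ, mul_assoc]

theorem IsInversive.exists_homothety_of_radii (hY : IsInversive Y) (x : Y) {r r' : ℝ} (hr : 0 < r)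
    (hr' : 0 < r') (h : ∃ y, dist y x = r) (h' : ∃ y, dist y x = r') :
    ∃ γ : Y ≃ Y, IsHomothety x ((r' / r) ^ 2) γ := by
  classical
  obtain ⟨φ, hφ, hφd, hφx, hφl⟩ := hY.exists_inversion x r hr h
  obtain ⟨ψ, hψ, hψd, hψx, hψl⟩ := hY.exists_inversion x r' hr' h'
  have key : ∀ f g : Y → Y, (∀ y, y ≠ x → f y ≠ x ∧ f (f y) = y) →
      (∀ y, y ≠ x → g y ≠ x ∧ g (g y) = y) → ∀ y,
      (fun y => if y = x then x else f (g y)) ((fun y => if y = x then x else g (f y)) y) = y := by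
    intro f g hf hg y
    by_cases hy : y = x
    · simp [hy]
    · have h1 := (hg _ (hf y hy).1)
      simp only [hy, if_false, h1.1, h1.2, (hf y hy).2]
  refine ⟨⟨fun y => if y = x then x else ψ (φ y), fun y => if y = x then x else φ (ψ y),
    key φ ψ hφ hψ, key ψ φ hψ hφ⟩, by positivity, by simp, fun y z => ?_, fun c hc hc0 t => ?_⟩
  · have aux : ∀ y, y ≠ x → dist (ψ (φ y)) x = (r' / r) ^ 2 * dist y x := by
      intro y hy
      have hyx := dist_pos.2 hy
      rw [hψx _ (hφ y hy).1, hφx y hy]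
      field_simp
    simp only [Equiv.coe_fn_mk]
    by_cases hy : y = x <;> by_cases hz : z = x
    · simp [hy, hz]
    · simp only [hy, hz, if_true, if_false]
      rw [dist_comm, aux z hz, dist_comm]
    · simp only [hy, hz, if_true, if_false]
      rw [aux y hy]
    · simp only [hy, hz, if_false]
      have hyx := dist_pos.2 hy
      have hzx := dist_pos.2 hz
      rw [hψd _ _ (hφ y hy).1 (hφ z hz).1, hφd y z hy hz, hφx y hy, hφx z hz]
      field_simp
  · simp only [Equiv.coe_fn_mk]
    by_cases ht : t = 0
    · simp [ht, hc0]
    · have hct : c t ≠ x := by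
        rw [← hc0]; exact fun h => ht (hc.injective h)
      rw [if_neg hct, hφl c hc hc0 t ht, hψl c hc hc0 _ (by
        rw [neg_ne_zero]; positivity)]
      congr 1
      field_simp

theorem exists_dist_eq_of_line {x : Y} {c : ℝ → Y} (hc : Isometry c) (hc0 : c 0 = x) {r : ℝ}
    (hr : 0 < r) : ∃ y, dist y x = r :=
  ⟨c r, by rw [← hc0, dist_line hc, sub_zero, abs_of_pos hr]⟩

theorem IsInversive.exists_homothety_of_line (hY : IsInversive Y) {x : Y} {c : ℝ → Y}
    (hc : Isometry c) (hc0 : c 0 = x) {k : ℝ} (hk : 0 < k) : ∃ γ : Y ≃ Y, IsHomothety x k γ := by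
  obtain ⟨γ, hγ⟩ := hY.exists_homothety_of_radii x one_pos (Real.sqrt_pos.2 hk)
    (exists_dist_eq_of_line hc hc0 one_pos) (exists_dist_eq_of_line hc hc0 (Real.sqrt_pos.2 hk))
  rw [div_one, Real.sq_sqrt hk.le] at hγ
  exact ⟨γ, hγ⟩

/-- Pointwise limits along an ultrafilter of pointwise bounded families of maps. -/
theorem exists_ultralimit [ProperSpace Y] {Z ι : Type*} (U : Ultrafilter ι) (F : ι → Z → Y)
    (o : Y) (R : Z → ℝ) (hR : ∀ i z, dist (F i z) o ≤ R z) :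
    ∃ G : Z → Y, ∀ z, Tendsto (fun i => F i z) U (𝓝 (G z)) := by
  have : ∀ z, ∃ y, Tendsto (fun i => F i z) U (𝓝 y) := by
    intro z
    obtain ⟨y, -, hy⟩ := (isCompact_closedBall o (R z)).ultrafilter_le_nhds
      (U.map fun i => F i z) (by
        rw [le_principal_iff]
        exact Filter.mem_map.2 (univ_mem' fun i => hR i z))
    exact ⟨y, hy⟩
  exact Classical.skolem.1 this

theorem IsInversive.exists_line_through [ProperSpace Y] (hY : IsInversive Y) (o : Y) :
    ∃ c : ℝ → Y, Isometry c ∧ c 0 = o := by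
  obtain ⟨c, hc⟩ := hY.exists_line
  have hbig : ∀ R : ℝ, ∃ t, R < dist (c t) o := by
    intro R
    refine ⟨|R| + dist (c 0) o + 1, ?_⟩
    have h1 := dist_triangle (c (|R| + dist (c 0) o + 1)) o (c 0)
    rw [dist_line hc, sub_zero, abs_of_nonneg (by positivity), dist_comm o] at h1
    linarith [le_abs_self R]
  obtain ⟨t, ht⟩ := hbig 0
  obtain ⟨t', ht'⟩ := hbig (dist (c t) o)
  obtain ⟨γ, hγ⟩ := hY.exists_homothety_of_radii o ht (ht.trans ht') ⟨_, rfl⟩ ⟨_, rfl⟩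
  set k : ℝ := (dist (c t') o / dist (c t) o) ^ 2 with hkdef
  have hk1 : 1 < k := by
    have : 1 < dist (c t') o / dist (c t) o := by rwa [one_lt_div ht]
    exact one_lt_pow₀ this two_ne_zero
  have hk0 : 0 < k := zero_lt_one.trans hk1
  have hex : ∀ n : ℕ, ∃ δ : Y ≃ Y, IsHomothety (c 0) (k ^ n) δ := fun n =>
    hY.exists_homothety_of_line hc rfl (by positivity)
  choose δ hδ using hex
  let F : ℕ → ℝ → Y := fun n s => (γ ^ n : Equiv.Perm Y).symm (δ n (c s))
  have hF : ∀ n s s', dist (F n s) (F n s') = |s - s'| := by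
    intro n s s'
    have hn : k ^ n ≠ 0 := by positivity
    simp only [F]
    rw [(hγ.pow n).symm.2.2.1, (hδ n).2.2.1, inv_mul_cancel_left₀ hn, dist_line hc]
  have hF0 : ∀ n, dist (F n 0) o = (k ^ n)⁻¹ * dist (c 0) o := by
    intro n
    have h := (hγ.pow n).symm.2.2.1 (c 0) o
    rw [(hγ.pow n).symm.2.1] at h
    simp only [F]
    rw [(hδ n).2.1, h]
  obtain ⟨G, hG⟩ := exists_ultralimit (hyperfilter ℕ) F o (fun s => |s| + dist (c 0) o) (by
    intro n s
    have h1 := dist_triangle (F n s) (F n 0) o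
    rw [hF, sub_zero, hF0] at h1
    have h2 : (k ^ n)⁻¹ * dist (c 0) o ≤ 1 * dist (c 0) o := by
      gcongr
      exact inv_le_one_of_one_le₀ (one_le_pow₀ hk1.le)
    linarith)
  refine ⟨G, isometry_of_dist fun s s' => ?_, ?_⟩
  · refine tendsto_nhds_unique ((hG s).dist (hG s')) ?_
    simp only [hF]
    exact tendsto_const_nhds
  · have h1 : Tendsto (fun n => dist (F n 0) o) (hyperfilter ℕ) (𝓝 0) := by
      simp only [hF0]
      have : Tendsto (fun n : ℕ => (k ^ n)⁻¹ * dist (c 0) o) atTop (𝓝 (0 * dist (c 0) o)) :=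
        ((tendsto_inv_atTop_zero.comp (tendsto_pow_atTop_atTop_of_one_lt hk1))).mul_const _
      rw [zero_mul] at this
      exact this.mono_left (Nat.hyperfilter_le_atTop)
    have h2 := (hG 0).dist (tendsto_const_nhds (x := o))
    exact dist_eq_zero.1 (tendsto_nhds_unique h2 h1)

theorem IsInversive.exists_homothety [ProperSpace Y] (hY : IsInversive Y) (x : Y) {k : ℝ}
    (hk : 0 < k) : ∃ γ : Y ≃ Y, IsHomothety x k γ := by
  obtain ⟨c, hc, hc0⟩ := hY.exists_line_through x
  exact hY.exists_homothety_of_line hc hc0 hk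

end Homothety

section Flatness

variable {Y : Type*} [MetricSpace Y]

/-- If the distance to `x` is differentiable along the line `c` at its point `o`, then opposite
Busemann functions of `c` cancel at the image of `x` under the inversion with center `o`. -/
theorem busemann_add_reverse_of_differentiableAt {c : ℝ → Y} (hc : Isometry c) {φ : Y → Y} {r : ℝ}
    (hr : r = 1)
    (hφd : ∀ y z, y ≠ c 0 → z ≠ c 0 →
      dist (φ y) (φ z) = r ^ 2 * dist y z / (dist y (c 0) * dist z (c 0)))
    (hφl : ∀ t, t ≠ 0 → φ (c t) = c (-(r ^ 2 / t))) {x : Y} (hx : x ≠ c 0)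
    (hdiff : DifferentiableAt ℝ (fun s => dist x (c s)) 0) :
    busemann c (φ x) + busemann (fun t => c (-t)) (φ x) = 0 := by
  subst hr
  set h : ℝ → ℝ := fun s => dist x (c s) with hh
  have hpos : 0 < h 0 := dist_pos.2 hx
  obtain ⟨m, hm⟩ : ∃ m, HasDerivAt h m 0 := ⟨_, hdiff.hasDerivAt⟩
  have hslope := hm.tendsto_slope_zero
  have hform : ∀ t : ℝ, t ≠ 0 → dist (φ x) (c t) = |t| * h (-t⁻¹) / h 0 := by
    intro t ht
    have h1 : -t⁻¹ ≠ 0 := neg_ne_zero.2 (inv_ne_zero ht)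
    have h2 : c t = φ (c (-t⁻¹)) := by
      rw [hφl _ h1]; congr 1; field_simp
    have h3 : c (-t⁻¹) ≠ c 0 := fun h => h1 (hc.injective h)
    rw [h2, hφd _ _ hx h3, dist_line hc, sub_zero, abs_neg, abs_inv]
    simp only [hh]
    have := abs_pos.2 ht
    field_simp
  have hinv : Tendsto (fun t : ℝ => t⁻¹) atTop (𝓝[≠] 0) :=
    tendsto_inv_atTop_nhdsGT_zero.mono_right (nhdsWithin_mono _ fun y hy => ne_of_gt hy)
  have hninv : Tendsto (fun t : ℝ => -t⁻¹) atTop (𝓝[≠] 0) := by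
    refine tendsto_nhdsWithin_iff.2 ⟨?_, ?_⟩
    · simpa using (tendsto_inv_atTop_zero (𝕜 := ℝ)).neg
    · filter_upwards [eventually_gt_atTop (0 : ℝ)] with t ht
      simpa using ht.ne'
  have hp : busemann c (φ x) = -m / h 0 := by
    refine busemann_eq hc ?_
    refine (((hslope.comp hninv).neg).div_const (h 0)).congr' ?_
    filter_upwards [eventually_gt_atTop (0 : ℝ)] with t ht
    rw [hform t ht.ne', abs_of_pos ht]
    simp only [Function.comp, zero_add, smul_eq_mul]
    field_simp
  have hq : busemann (fun t => c (-t)) (φ x) = m / h 0 := by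
    refine busemann_eq (isometry_reverse hc) ?_
    refine ((hslope.comp hinv).div_const (h 0)).congr' ?_
    filter_upwards [eventually_gt_atTop (0 : ℝ)] with t ht
    rw [hform (-t) (neg_ne_zero.2 ht.ne'), abs_neg, abs_of_pos ht]
    simp only [Function.comp, zero_add, smul_eq_mul, inv_neg, neg_neg]
    field_simp
  rw [hp, hq]
  ring

variable [ProperSpace Y]

theorem IsInversive.exists_translation (hY : IsInversive Y) {c : ℝ → Y} (hc : Isometry c) (s : ℝ) :
    ∃ T : Y → Y, (∀ y z, dist (T y) (T z) = dist y z) ∧ ∀ u, T (c u) = c (u + s) := by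
  obtain ⟨γ, -, -, hγd, hγl⟩ := hY.exists_homothety (c 0) two_pos
  obtain ⟨δ, -, -, hδd, hδl⟩ := hY.exists_homothety (c (2 * s)) (inv_pos.2 two_pos)
  refine ⟨fun y => δ (γ y), fun y z => ?_, fun u => ?_⟩
  · rw [hδd, hγd, inv_mul_cancel_left₀ two_ne_zero]
  · have h := hδl _ (isometry_translate hc (2 * s)) (by simp) (2 * u - 2 * s)
    change δ (c (2 * s + (2 * u - 2 * s))) = c (2 * s + 2⁻¹ * (2 * u - 2 * s)) at h
    change δ (γ (c u)) = c (u + s)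
    rw [hγl c hc rfl]
    rw [show 2 * s + (2 * u - 2 * s) = 2 * u by ring] at h
    rw [h]
    congr 1
    ring

theorem IsInversive.busemann_add_reverse (hY : IsInversive Y) {c : ℝ → Y} (hc : Isometry c)
    (z : Y) : busemann c z + busemann (fun t => c (-t)) z = 0 := by
  by_cases hz : z = c 0
  · rw [hz, busemann_zero hc, busemann_reverse_line hc, add_zero]
  obtain ⟨φ, hφ, hφd, hφx, hφl⟩ := hY.exists_inversion (c 0) 1 one_pos
    (exists_dist_eq_of_line hc rfl one_pos)
  replace hφl := hφl c hc rfl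
  set x := φ z with hx
  have hxz : φ x = z := (hφ z hz).2
  have hx0 : x ≠ c 0 := (hφ z hz).1
  set f : Y → ℝ := fun y => busemann c y + busemann (fun t => c (-t)) y with hf
  have hfc : Continuous f :=
    (continuous_busemann hc).add (continuous_busemann (isometry_reverse hc))
  change f z = 0
  -- differentiability of the distance function along a sequence converging to zero
  have hae := (lipschitzWith_dist_line hc x).ae_differentiableAt_real
  have hdense : ∀ n : ℕ, ∃ s : ℝ, |s| < 1 / ((n : ℝ) + 1) ∧
      DifferentiableAt ℝ (fun s => dist x (c s)) s := by
    intro n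
    have hd := MeasureTheory.Measure.dense_of_ae hae
    obtain ⟨s, hs, hs'⟩ := Metric.dense_iff.1 hd 0 (1 / ((n : ℝ) + 1)) (by positivity)
    exact ⟨s, by simpa [Real.dist_eq] using hs, hs'⟩
  choose s hs hsd using hdense
  have hs0 : Tendsto s atTop (𝓝 0) :=
    squeeze_zero_norm (fun n => (hs n).le) tendsto_one_div_add_atTop_nhds_zero_nat
  have hT := fun n => hY.exists_translation hc (-(s n))
  choose T hTd hTl using hT
  have hdist : ∀ n u, dist (T n x) (c u) = dist x (c (u + s n)) := by
    intro n u
    rw [← hTd n x, hTl]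
    congr 2
    ring
  have hlim : ∀ u, Tendsto (fun n => dist (T n x) (c u)) atTop (𝓝 (dist x (c u))) := by
    intro u
    simp only [hdist]
    have h1 : Tendsto (fun n => u + s n) atTop (𝓝 u) := by simpa using hs0.const_add u
    exact ((lipschitzWith_dist_line hc x).continuous.tendsto u).comp h1
  obtain ⟨y, -, ψ, hψ, hy⟩ := tendsto_subseq_of_bounded (x := fun n => T n x)
    (s := Metric.closedBall (c 0) (dist x (c 0) + 1)) Metric.isBounded_closedBall (by
      intro n
      rw [Metric.mem_closedBall, hdist]
      have h1 := dist_triangle x (c 0) (c (0 + s n))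
      rw [dist_line hc, zero_add, zero_sub, abs_neg] at h1
      have h2 := (hs n).le
      have h3 : 1 / ((n : ℝ) + 1) ≤ 1 := by
        rw [div_le_one (by positivity)]; linarith [n.cast_nonneg (α := ℝ)]
      rw [zero_add]
      linarith)
  have hyd : ∀ u, dist y (c u) = dist x (c u) := fun u =>
    tendsto_nhds_unique (hy.dist tendsto_const_nhds) ((hlim u).comp hψ.tendsto_atTop)
  have hy0 : y ≠ c 0 := by
    rw [← dist_pos, hyd, dist_pos]; exact hx0
  have hne : ∀ᶠ n in atTop, T (ψ n) x ≠ c 0 := hy.eventually_ne hy0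
  have hzero : ∀ n, T n x ≠ c 0 → f (φ (T n x)) = 0 := by
    intro n hn
    refine busemann_add_reverse_of_differentiableAt hc rfl hφd hφl hn ?_
    simp only [hdist]
    have h1 : DifferentiableAt ℝ (fun s => dist x (c s)) (0 + s n) := by
      rw [zero_add]; exact hsd n
    exact DifferentiableAt.comp (g := fun s => dist x (c s)) 0 h1
      (differentiableAt_id.add_const (s n))
  have hφy : Tendsto (fun n => φ (T (ψ n) x)) atTop (𝓝 (φ y)) := by
    rw [tendsto_iff_dist_tendsto_zero]
    have h1 : Tendsto (fun n => (1 : ℝ) ^ 2 * dist (T (ψ n) x) y /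
        (dist (T (ψ n) x) (c 0) * dist y (c 0))) atTop
        (𝓝 ((1 : ℝ) ^ 2 * dist y y / (dist y (c 0) * dist y (c 0)))) := by
      refine Tendsto.div ?_ ?_ ?_
      · exact (hy.dist tendsto_const_nhds).const_mul _
      · exact (hy.dist tendsto_const_nhds).mul_const _
      · have := dist_pos.2 hy0
        positivity
    simp only [dist_self, mul_zero, zero_div] at h1
    refine h1.congr' ?_
    filter_upwards [hne] with n hn
    rw [hφd _ _ hn hy0]
  have hfy : f (φ y) = 0 := by
    refine tendsto_nhds_unique ((hfc.tendsto _).comp hφy) ?_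
    refine tendsto_const_nhds.congr' ?_
    filter_upwards [hne] with n hn
    exact (hzero _ hn).symm
  have hsame : ∀ t : ℝ, t ≠ 0 → dist (φ y) (c t) = dist (φ x) (c t) := by
    intro t ht
    have h1 : -t⁻¹ ≠ 0 := neg_ne_zero.2 (inv_ne_zero ht)
    have h2 : c t = φ (c (-t⁻¹)) := by
      rw [hφl _ h1]; congr 1; field_simp
    have h3 : c (-t⁻¹) ≠ c 0 := fun h => h1 (hc.injective h)
    rw [h2, hφd _ _ hx0 h3, hφd _ _ hy0 h3, hyd, hyd]
  have hb1 : busemann c (φ y) = busemann c (φ x) := by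
    refine busemann_eq hc ((tendsto_busemann hc (φ x)).congr' ?_)
    filter_upwards [eventually_gt_atTop (0 : ℝ)] with t ht
    rw [hsame t ht.ne']
  have hb2 : busemann (fun t => c (-t)) (φ y) = busemann (fun t => c (-t)) (φ x) := by
    refine busemann_eq (isometry_reverse hc)
      ((tendsto_busemann (isometry_reverse hc) (φ x)).congr' ?_)
    filter_upwards [eventually_gt_atTop (0 : ℝ)] with t ht
    rw [hsame (-t) (neg_ne_zero.2 ht.ne')]
  rw [← hfy, ← hxz]
  simp only [hf, hb1, hb2]

theorem IsInversive.busemann_reverse (hY : IsInversive Y) {c : ℝ → Y} (hc : Isometry c) (z : Y) :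
    busemann (fun t => c (-t)) z = -busemann c z := by
  linarith [hY.busemann_add_reverse hc z]

/-- Busemann functions are affine along geodesic lines. -/
theorem IsInversive.busemann_affine (hY : IsInversive Y) {c e : ℝ → Y} (hc : Isometry c)
    (he : Isometry e) (t : ℝ) :
    busemann c (e t) = busemann c (e 0) + t * (busemann c (e 1) - busemann c (e 0)) := by
  have key : ∀ {u v w : ℝ}, u ≤ v → v ≤ w →
      (w - u) * busemann c (e v) = (w - v) * busemann c (e u) + (v - u) * busemann c (e w) := by
    intro u v w huv hvw
    have h1 := hY.busemann_convex hc he huv hvw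
    have h2 := hY.busemann_convex (isometry_reverse hc) he huv hvw
    simp only [hY.busemann_reverse hc] at h2
    linarith
  rcases le_total t 0 with h | h
  · linarith [key h zero_le_one]
  rcases le_total t 1 with h' | h'
  · linarith [key h h']
  · linarith [key zero_le_one h']

end Flatness

section Shift

variable {Y : Type*} [MetricSpace Y]

theorem busemann_isometry {c : ℝ → Y} (hc : Isometry c) {T : Y → Y} (hT : Isometry T) (y : Y) :
    busemann (fun t => T (c t)) (T y) = busemann c y := by
  refine busemann_eq (hT.comp hc) ((tendsto_busemann hc y).congr fun t => ?_)
  rw [Function.comp, hT.dist_eq]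

theorem IsHomothety.busemann_of_line {x : Y} {k : ℝ} {γ : Y ≃ Y} (h : IsHomothety x k γ)
    {c : ℝ → Y} (hc : Isometry c) (hc0 : c 0 = x) (y : Y) :
    busemann c (γ y) = k * busemann c y := by
  obtain ⟨hk, -, hd, hl⟩ := h
  have h1 := (tendsto_busemann hc (γ y)).comp (tendsto_id.const_mul_atTop hk)
  refine tendsto_nhds_unique h1 (((tendsto_busemann hc y).const_mul k).congr fun t => ?_)
  simp only [Function.comp, id]
  rw [← hl c hc hc0, hd]
  ring

variable [ProperSpace Y]

/-- Geodesic lines along which the Busemann function of `c` descends with unit speed are parallel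
to `c`: the Busemann functions of both lines agree up to a constant. -/
theorem IsInversive.busemann_parallel (hY : IsInversive Y) {c e : ℝ → Y} (hc : Isometry c)
    (he : Isometry e) (h : ∀ t, busemann c (e t) = busemann c (e 0) - t) (y : Y) :
    busemann c y = busemann c (e 0) + busemann e y := by
  have key : ∀ {c e : ℝ → Y}, Isometry c → Isometry e →
      (∀ t, busemann c (e t) = busemann c (e 0) - t) →
      busemann c y ≤ busemann c (e 0) + busemann e y := by
    intro c e hc he h
    refine ge_of_tendsto ((tendsto_busemann he y).const_add (busemann c (e 0)))
      (Eventually.of_forall fun t => ?_)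
    have := busemann_le hc y (e t)
    rw [h] at this
    linarith
  refine le_antisymm (key hc he h) ?_
  have h2 := key (isometry_reverse hc) (isometry_reverse he) (fun t => by
    rw [hY.busemann_reverse hc, hY.busemann_reverse hc, h, neg_zero]; ring)
  rw [hY.busemann_reverse hc, hY.busemann_reverse hc, hY.busemann_reverse he, neg_zero] at h2
  linarith

theorem IsInversive.exists_shift_aux (hY : IsInversive Y) (o x : Y) :
    ∃ T : Y ≃ᵢ Y, T o = x ∧ ∀ c : ℝ → Y, Isometry c → c 0 = o → ∀ y,
      busemann c y = busemann c x + busemann (fun t => T (c t)) y := by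
  have hk : ∀ n : ℕ, (0 : ℝ) < (n : ℝ) + 1 := fun n => by positivity
  choose A hA using fun n : ℕ => hY.exists_homothety o (hk n)
  choose B hB using fun n : ℕ => hY.exists_homothety x (hk n)
  have hbound : ∀ n : ℕ, ((n : ℝ) + 1)⁻¹ * dist o x ≤ dist o x := fun n =>
    mul_le_of_le_one_left dist_nonneg (inv_le_one_of_one_le₀ (by simp))
  have hFd : ∀ n y z, dist ((B n).symm (A n y)) ((B n).symm (A n z)) = dist y z := fun n y z => by
    rw [(hB n).symm.2.2.1, (hA n).2.2.1, inv_mul_cancel_left₀ (hk n).ne']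
  have hFd' : ∀ n y z, dist ((A n).symm (B n y)) ((A n).symm (B n z)) = dist y z := fun n y z => by
    rw [(hA n).symm.2.2.1, (hB n).2.2.1, inv_mul_cancel_left₀ (hk n).ne']
  have hFo : ∀ n, dist ((B n).symm (A n o)) x = ((n : ℝ) + 1)⁻¹ * dist o x := fun n => by
    have := (hB n).symm.2.2.1 o x
    rwa [(hB n).symm.2.1, ← congrArg (B n).symm (hA n).2.1] at this
  have hFx : ∀ n, dist ((A n).symm (B n x)) o = ((n : ℝ) + 1)⁻¹ * dist o x := fun n => by
    have := (hA n).symm.2.2.1 x o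
    rwa [(hA n).symm.2.1, ← congrArg (A n).symm (hB n).2.1, dist_comm x] at this
  obtain ⟨T, hT⟩ := exists_ultralimit (hyperfilter ℕ) (fun n y => (B n).symm (A n y)) x
    (fun y => dist y o + dist o x) (fun n y => by
      have h1 := dist_triangle ((B n).symm (A n y)) ((B n).symm (A n o)) x
      rw [hFd, hFo] at h1
      exact h1.trans (add_le_add_right (hbound n) _))
  obtain ⟨T', hT'⟩ := exists_ultralimit (hyperfilter ℕ) (fun n y => (A n).symm (B n y)) o
    (fun y => dist y x + dist o x) (fun n y => by
      have h1 := dist_triangle ((A n).symm (B n y)) ((A n).symm (B n x)) o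
      rw [hFd', hFx] at h1
      exact h1.trans (add_le_add_right (hbound n) _))
  have hsmall : Tendsto (fun n : ℕ => ((n : ℝ) + 1)⁻¹) (hyperfilter ℕ) (𝓝 0) := by
    have := tendsto_one_div_add_atTop_nhds_zero_nat (𝕜 := ℝ)
    simp only [one_div] at this
    exact this.mono_left Nat.hyperfilter_le_atTop
  have hTo : T o = x := by
    refine dist_eq_zero.1 (tendsto_nhds_unique ((hT o).dist (tendsto_const_nhds (x := x))) ?_)
    simp only [hFo]
    simpa using hsmall.mul_const (dist o x)
  have hTi : Isometry T := Isometry.of_dist_eq fun y z => by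
    refine tendsto_nhds_unique ((hT y).dist (hT z)) ?_
    simp only [hFd]
    exact tendsto_const_nhds
  have hl : ∀ y, T' (T y) = y := fun y => by
    refine dist_eq_zero.1 (tendsto_nhds_unique
      ((hT' (T y)).dist (tendsto_const_nhds (x := y))) ?_)
    have h1 := (tendsto_const_nhds (x := T y)).dist (hT y)
    rw [dist_self] at h1
    refine h1.congr fun n => ?_
    rw [← hFd' n, Equiv.apply_symm_apply, Equiv.symm_apply_apply]
  have hr : ∀ y, T (T' y) = y := fun y => by
    refine dist_eq_zero.1 (tendsto_nhds_unique
      ((hT (T' y)).dist (tendsto_const_nhds (x := y))) ?_)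
    have h1 := (tendsto_const_nhds (x := T' y)).dist (hT' y)
    rw [dist_self] at h1
    refine h1.congr fun n => ?_
    rw [← hFd n, Equiv.apply_symm_apply, Equiv.symm_apply_apply]
  refine ⟨⟨⟨T, T', hl, hr⟩, hTi⟩, hTo, fun c hc hc0 y => ?_⟩
  change busemann c y = busemann c x + busemann (fun t => T (c t)) y
  have he : Isometry fun t => T (c t) := hTi.comp hc
  have he0 : T (c 0) = x := by rw [hc0, hTo]
  have hmain := hY.busemann_parallel hc he (fun t => ?_) y
  · rwa [he0] at hmain
  have haff := hY.busemann_affine hc he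
  simp only [he0] at haff ⊢
  have h1 : busemann c (T' (T (c t))) = t * (busemann c (T (c 1)) - busemann c x) := by
    refine tendsto_nhds_unique (((continuous_busemann hc).tendsto _).comp (hT' (T (c t)))) ?_
    have h2 := (hsmall.mul_const (busemann c x)).add_const
      (t * (busemann c (T (c 1)) - busemann c x))
    rw [zero_mul, zero_add] at h2
    refine h2.congr fun n => ?_
    have := hk n
    simp only [Function.comp]
    rw [(hA n).symm.busemann_of_line hc hc0, (hB n).2.2.2 _ he he0, haff (((n : ℝ) + 1) * t)]
    field_simp
  rw [hl, busemann_line hc] at h1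
  rw [haff, ← h1]
  ring

/-- Every geodesic line has a parallel one through every point. -/
theorem IsInversive.exists_parallel (hY : IsInversive Y) {c : ℝ → Y} (hc : Isometry c) (x : Y) :
    ∃ e : ℝ → Y, Isometry e ∧ e 0 = x ∧ ∀ y, busemann c y = busemann c x + busemann e y := by
  obtain ⟨T, hT, h⟩ := hY.exists_shift_aux (c 0) x
  exact ⟨_, T.isometry.comp hc, hT, h c hc rfl⟩

/-- Isometries which act as translations on all Busemann functions are transitive. -/
theorem IsInversive.exists_shift (hY : IsInversive Y) (o x : Y) :
    ∃ T : Y ≃ᵢ Y, T o = x ∧ ∀ c : ℝ → Y, Isometry c → ∀ y,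
      busemann c (T y) = busemann c y + (busemann c x - busemann c o) := by
  obtain ⟨T, hT, h⟩ := hY.exists_shift_aux o x
  refine ⟨T, hT, fun c hc y => ?_⟩
  obtain ⟨e, he, he0, hce⟩ := hY.exists_parallel hc o
  have h1 := h e he he0 (T y)
  rw [busemann_isometry he T.isometry] at h1
  linarith [hce (T y), hce x, hce y]

theorem IsInversive.busemann_homothety (hY : IsInversive Y) {x : Y} {k : ℝ} {γ : Y ≃ Y}
    (h : IsHomothety x k γ) {c : ℝ → Y} (hc : Isometry c) (y : Y) :
    busemann c (γ y) - busemann c x = k * (busemann c y - busemann c x) := by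
  obtain ⟨e, he, he0, hce⟩ := hY.exists_parallel hc x
  rw [hce (γ y), hce y, h.busemann_of_line he he0]
  ring

end Shift

section Fibers

variable {Y : Type*} [MetricSpace Y]

/-- Points with the same values of all Busemann functions. -/
def SameFiber (x y : Y) : Prop :=
  ∀ c : ℝ → Y, Isometry c → busemann c x = busemann c y

theorem SameFiber.symm {x y : Y} (h : SameFiber x y) : SameFiber y x :=
  fun c hc => (h c hc).symm

theorem SameFiber.trans {x y z : Y} (h : SameFiber x y) (h' : SameFiber y z) : SameFiber x z :=
  fun c hc => (h c hc).trans (h' c hc)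

theorem isClosed_sameFiber (y : Y) : IsClosed {z | SameFiber z y} := by
  simp only [SameFiber, Set.ofPred_forall]
  exact isClosed_iInter fun c => isClosed_iInter fun hc =>
    isClosed_eq (continuous_busemann hc) continuous_const

theorem abs_sub_le_dist_of_sameFiber {c : ℝ → Y} (hc : Isometry c) {s t : ℝ} {x y : Y}
    (hx : SameFiber x (c s)) (hy : SameFiber y (c t)) : |s - t| ≤ dist x y := by
  have h := abs_busemann_sub_le hc x y
  rw [hx c hc, hy c hc, busemann_line hc, busemann_line hc, ← abs_neg] at h
  simpa [add_comm, sub_eq_add_neg] using h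

theorem tendsto_floor_mul_div (a : ℝ) :
    Tendsto (fun n : ℕ => ((n : ℝ) + 1)⁻¹ * (⌊a * ((n : ℝ) + 1)⌋ : ℝ)) atTop (𝓝 a) := by
  have h0 : Tendsto (fun n : ℕ => ((n : ℝ) + 1)⁻¹) atTop (𝓝 0) := by
    simpa using tendsto_one_div_add_atTop_nhds_zero_nat (𝕜 := ℝ)
  have h1 : Tendsto (fun n : ℕ => a - ((n : ℝ) + 1)⁻¹) atTop (𝓝 a) := by
    simpa using h0.const_sub a
  refine tendsto_of_tendsto_of_tendsto_of_le_of_le h1 tendsto_const_nhds (fun n => ?_) fun n => ?_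
  · have hn : (0 : ℝ) < (n : ℝ) + 1 := by positivity
    have := Int.sub_one_lt_floor (a * ((n : ℝ) + 1))
    rw [inv_mul_eq_div, le_div_iff₀ hn, sub_mul, inv_mul_cancel₀ hn.ne']
    exact this.le
  · have hn : (0 : ℝ) < (n : ℝ) + 1 := by positivity
    rw [inv_mul_eq_div, div_le_iff₀ hn]
    exact Int.floor_le _

variable [ProperSpace Y]

/-- Any point can be joined to any fiber by a geodesic line. -/
theorem IsInversive.exists_line_to_fiber (hY : IsInversive Y) (x y : Y) :
    ∃ e : ℝ → Y, Isometry e ∧ e 0 = x ∧ ∃ δ, 0 ≤ δ ∧ SameFiber (e δ) y := by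
  obtain ⟨x₀, hx₀, hmin⟩ := (isClosed_sameFiber y).exists_infDist_eq_dist ⟨y, fun _ _ => rfl⟩ x
  replace hmin : ∀ z, SameFiber z y → dist x x₀ ≤ dist x z := fun z hz =>
    hmin ▸ Metric.infDist_le_dist_of_mem hz
  rcases eq_or_ne x x₀ with rfl | hne
  · obtain ⟨e, he, he0⟩ := hY.exists_line_through x
    exact ⟨e, he, he0, 0, le_rfl, he0 ▸ hx₀⟩
  set δ := dist x x₀ with hδ
  have hδ0 : 0 < δ := dist_pos.2 hne
  obtain ⟨T, hT, hTb⟩ := hY.exists_shift x x₀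
  have hpow : ∀ (n : ℕ) (c : ℝ → Y), Isometry c →
      busemann c ((T ^ n) x) - busemann c x = n * (busemann c x₀ - busemann c x) := by
    intro n c hc
    induction n with
    | zero => simp
    | succ n ih =>
      rw [pow_succ', IsometryEquiv.mul_apply, hTb c hc]
      push_cast
      linarith
  choose γ hγ using fun n : ℕ => hY.exists_homothety x (k := ((n : ℝ) + 1)⁻¹) (by positivity)
  have hγT : ∀ n : ℕ, SameFiber (γ n ((T ^ (n + 1)) x)) x₀ := by
    intro n c hc
    have h1 := hY.busemann_homothety (hγ n) hc ((T ^ (n + 1)) x)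
    rw [hpow (n + 1) c hc] at h1
    push_cast at h1
    have hn : (n : ℝ) + 1 ≠ 0 := by positivity
    rw [inv_mul_cancel_left₀ hn] at h1
    linarith
  have hdist : ∀ n : ℕ, dist x ((T ^ n) x) = n * δ := by
    intro n
    refine le_antisymm ?_ ?_
    · induction n with
      | zero => simp
      | succ n ih =>
        have h1 := dist_triangle x ((T ^ n) x) ((T ^ (n + 1)) x)
        have h2 : dist ((T ^ n) x) ((T ^ (n + 1)) x) = δ := by
          rw [pow_succ, IsometryEquiv.mul_apply, IsometryEquiv.dist_eq, hT]
        push_cast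
        linarith
    · rcases n with _ | n
      · simp
      · have h1 := hmin _ ((hγT n).trans hx₀)
        have h2 := (hγ n).2.2.1 x ((T ^ (n + 1)) x)
        rw [(hγ n).2.1] at h2
        rw [h2, inv_mul_eq_div, le_div_iff₀ (by positivity)] at h1
        push_cast
        linarith
  have hdistz : ∀ m n : ℤ, dist ((T ^ m) x) ((T ^ n) x) = |(m : ℝ) - n| * δ := by
    have aux : ∀ (m : ℤ) (n : ℕ), dist ((T ^ m) x) ((T ^ (m + n)) x) = n * δ := by
      intro m n
      rw [zpow_add, IsometryEquiv.mul_apply, IsometryEquiv.dist_eq, zpow_natCast, hdist]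
    intro m n
    rcases le_total m n with h | h
    · obtain ⟨k, rfl⟩ := Int.le.dest h
      rw [aux]
      simp
    · obtain ⟨k, rfl⟩ := Int.le.dest h
      rw [dist_comm, aux]
      simp
  let F : ℕ → ℝ → Y := fun n t => γ n ((T ^ ⌊t / δ * ((n : ℝ) + 1)⌋) x)
  have hFd : ∀ n s t, dist (F n s) (F n t) = |((n : ℝ) + 1)⁻¹ * (⌊s / δ * ((n : ℝ) + 1)⌋ : ℝ) -
      ((n : ℝ) + 1)⁻¹ * (⌊t / δ * ((n : ℝ) + 1)⌋ : ℝ)| * δ := by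
    intro n s t
    simp only [F]
    rw [(hγ n).2.2.1, hdistz, ← mul_sub, abs_mul, abs_of_pos (by positivity : (0 : ℝ) <
      ((n : ℝ) + 1)⁻¹), mul_assoc]
  have hF0 : ∀ n, F n 0 = x := by
    intro n
    simp only [F, zero_div, zero_mul, Int.floor_zero, zpow_zero]
    exact (hγ n).2.1
  have hFlim : ∀ s t, Tendsto (fun n => dist (F n s) (F n t)) (hyperfilter ℕ) (𝓝 |s - t|) := by
    intro s t
    simp only [hFd]
    have h1 := (((tendsto_floor_mul_div (s / δ)).sub
      (tendsto_floor_mul_div (t / δ))).abs).mul_const δ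
    have h2 : |s / δ - t / δ| * δ = |s - t| := by
      rw [← sub_div, abs_div, abs_of_pos hδ0, div_mul_cancel₀ _ hδ0.ne']
    rw [h2] at h1
    exact h1.mono_left Nat.hyperfilter_le_atTop
  obtain ⟨e, he⟩ := exists_ultralimit (hyperfilter ℕ) F x (fun t => |t| + δ) (by
    intro n t
    rw [← hF0 n, hFd]
    simp only [zero_div, zero_mul, Int.floor_zero, Int.cast_zero, mul_zero, sub_zero]
    have hn : (0 : ℝ) < (n : ℝ) + 1 := by positivity
    have h1 := Int.floor_le (t / δ * ((n : ℝ) + 1))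
    have h2 := Int.sub_one_lt_floor (t / δ * ((n : ℝ) + 1))
    have h3 : |(⌊t / δ * ((n : ℝ) + 1)⌋ : ℝ)| ≤ (|t| / δ + 1) * ((n : ℝ) + 1) := by
      have h4 : |t / δ * ((n : ℝ) + 1)| = |t| / δ * ((n : ℝ) + 1) := by
        rw [abs_mul, abs_div, abs_of_pos hδ0, abs_of_pos hn]
      have h5 := le_abs_self (t / δ * ((n : ℝ) + 1))
      have h6 := neg_abs_le (t / δ * ((n : ℝ) + 1))
      have h7 : (0 : ℝ) ≤ n := n.cast_nonneg
      rw [h4] at h5 h6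
      rw [abs_le]
      constructor <;> nlinarith
    rw [abs_mul, abs_of_pos (inv_pos.2 hn)]
    calc _ ≤ ((n : ℝ) + 1)⁻¹ * ((|t| / δ + 1) * ((n : ℝ) + 1)) * δ := by gcongr
      _ = |t| + δ := by field_simp)
  refine ⟨e, isometry_of_dist fun s t => ?_, ?_, δ, hδ0.le, ?_⟩
  · exact tendsto_nhds_unique ((he s).dist (he t)) (hFlim s t)
  · refine tendsto_nhds_unique (he 0) ?_
    simp only [hF0]
    exact tendsto_const_nhds
  · refine SameFiber.trans (fun c hc => ?_) hx₀
    refine tendsto_nhds_unique (((continuous_busemann hc).tendsto _).comp (he δ))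
      (tendsto_const_nhds.congr fun n => ?_)
    simp only [Function.comp, F]
    have h1 : ⌊δ / δ * ((n : ℝ) + 1)⌋ = ((n + 1 : ℕ) : ℤ) := by
      rw [div_self hδ0.ne', one_mul, ← Nat.cast_succ, Int.floor_natCast]
    rw [h1, zpow_natCast]
    exact (hγT n c hc).symm

theorem IsInversive.busemann_ray (hY : IsInversive Y) {c e : ℝ → Y} (hc : Isometry c)
    (he : Isometry e) (hce : c 0 = e 0) (t : ℝ) : busemann c (e t) = t * busemann c (e 1) := by
  have := hY.busemann_affine hc he t
  rwa [← hce, busemann_zero hc, zero_add, sub_zero] at this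

/-- The directional derivatives of Busemann functions are symmetric. -/
theorem IsInversive.busemann_symm (hY : IsInversive Y) {c e : ℝ → Y} (hc : Isometry c)
    (he : Isometry e) (hce : c 0 = e 0) : busemann c (e 1) = busemann e (c 1) := by
  obtain ⟨φ, -, hφd, -, hφl⟩ := hY.exists_inversion (c 0) 1 one_pos
    (exists_dist_eq_of_line hc rfl one_pos)
  have key : ∀ t : ℝ, 0 < t → dist (e (-1)) (c (-t)) = dist (c 1) (e t) := by
    intro t ht
    obtain ⟨γ, -, -, hγd, hγl⟩ := hY.exists_homothety (c 0) ht
    have h1 : c 1 ≠ c 0 := fun h => one_ne_zero (hc.injective h)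
    have h2 : e t ≠ c 0 := fun h => ht.ne' (he.injective (h.trans hce))
    have h3 := hφd (c 1) (e t) h1 h2
    rw [hφl c hc rfl 1 one_ne_zero, hφl e he hce.symm t ht.ne', hce, dist_line he,
      ← hce, dist_line hc] at h3
    have h4 := hγd (c (-(1 ^ 2 / 1))) (e (-(1 ^ 2 / t)))
    rw [hγl c hc rfl, hγl e he hce.symm, h3] at h4
    rw [dist_comm]
    convert h4 using 1
    · congr 2
      · ring
      · field_simp
    · rw [sub_zero, sub_zero, abs_one, abs_of_pos ht]
      field_simp
  have h1 : busemann e (c 1) = busemann (fun t => c (-t)) (e (-1)) := by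
    refine busemann_eq he ((tendsto_busemann (isometry_reverse hc) _).congr' ?_)
    filter_upwards [eventually_gt_atTop (0 : ℝ)] with t ht
    rw [key t ht]
  rw [h1, hY.busemann_reverse hc, hY.busemann_ray hc he hce (-1)]
  ring

end Fibers

section Euclidean

theorem exists_linearEquiv_euclideanSpace {V Y : Type*} [AddCommGroup V] [Module ℝ V]
    [MetricSpace Y] [ProperSpace Y] (B : V → V → ℝ) (hsymm : ∀ p q, B p q = B q p)
    (hadd : ∀ p p' q, B (p + p') q = B p q + B p' q)
    (hsmul : ∀ (a : ℝ) p q, B (a • p) q = a * B p q) (hnonneg : ∀ p, 0 ≤ B p p) (hdef : ∀ p, B p p = 0 → p = 0) (Φ : Y → V)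
    (hΦ : ∀ x y, B (Φ x - Φ y) (Φ x - Φ y) ≤ dist x y ^ 2) (o : Y)
    (hsurj : ∀ p, ∃ x, Φ x = p ∧ dist x o ^ 2 = B p p) (hne : ∃ p : V, p ≠ 0) :
    ∃ k : ℕ, 1 ≤ k ∧ ∃ f : V ≃ₗ[ℝ] EuclideanSpace ℝ (Fin k), ∀ p, ‖f p‖ ^ 2 = B p p := by
  let core : InnerProductSpace.Core ℝ V :=
    { inner := B
      conj_inner_symm := fun p q => by simpa using hsymm q p
      re_inner_nonneg := fun p => by simpa using hnonneg p
      add_left := hadd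
      smul_left := fun p q a => by simpa using hsmul a p q
      definite := hdef }
  let : NormedAddCommGroup V := core.toNormedAddCommGroup
  let : InnerProductSpace ℝ V := InnerProductSpace.ofCore core.toCore
  have hnorm : ∀ p : V, ‖p‖ ^ 2 = B p p := fun p => (real_inner_self_eq_norm_sq p).symm
  have hlip : LipschitzWith 1 Φ := LipschitzWith.of_dist_le_mul fun x y => by
    rw [NNReal.coe_one, one_mul, dist_eq_norm]
    refine le_of_sq_le_sq ?_ dist_nonneg
    rw [hnorm]
    exact hΦ x y
  have hcomp : IsCompact (Metric.closedBall (0 : V) 1) := by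
    refine ((isCompact_closedBall o 1).image hlip.continuous).of_isClosed_subset
      Metric.isClosed_closedBall fun p hp => ?_
    obtain ⟨x, rfl, hx⟩ := hsurj p
    rw [← hnorm] at hx
    refine ⟨x, ?_, rfl⟩
    rw [Metric.mem_closedBall, (sq_eq_sq₀ dist_nonneg (norm_nonneg _)).1 hx]
    exact mem_closedBall_zero_iff.1 hp
  have : FiniteDimensional ℝ V := FiniteDimensional.of_isCompact_closedBall ℝ one_pos hcomp
  have : Nontrivial V := nontrivial_iff.2 (let ⟨p, hp⟩ := hne; ⟨p, 0, hp⟩)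
  refine ⟨Module.finrank ℝ V, Module.finrank_pos, (stdOrthonormalBasis ℝ V).repr.toLinearEquiv,
    fun p => ?_⟩
  rw [← hnorm]
  congr 1
  exact (stdOrthonormalBasis ℝ V).repr.norm_map p

/-- The coordinates of a point given by all Busemann functions, normalized at `o`. -/
noncomputable def busemannMap {Y : Type*} [MetricSpace Y] (o x : Y) :
    {c : ℝ → Y // Isometry c} → ℝ :=
  fun c => busemann c.1 x - busemann c.1 o

variable {Y : Type*} [MetricSpace Y]

theorem busemannMap_eq_iff {o x y : Y} : busemannMap o x = busemannMap o y ↔ SameFiber x y := by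
  simp only [funext_iff, busemannMap, sub_left_inj, Subtype.forall, SameFiber]

variable [ProperSpace Y]

theorem IsInversive.busemannMap_smul (hY : IsInversive Y) {e : ℝ → Y} (he : Isometry e) (a t : ℝ) :
    busemannMap (e 0) (e (a * t)) = a • busemannMap (e 0) (e t) := by
  ext c
  simp only [busemannMap, Pi.smul_apply, smul_eq_mul]
  rw [hY.busemann_affine c.2 he (a * t), hY.busemann_affine c.2 he t]
  ring

/-- The vector space of all Busemann coordinates. -/
def IsInversive.busemannSpace (hY : IsInversive Y) (o : Y) :
    Submodule ℝ ({c : ℝ → Y // Isometry c} → ℝ) where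
  carrier := Set.range (busemannMap o)
  add_mem' := by
    rintro _ _ ⟨x, rfl⟩ ⟨y, rfl⟩
    obtain ⟨T, -, hT⟩ := hY.exists_shift o x
    refine ⟨T y, ?_⟩
    ext c
    simp only [busemannMap, Pi.add_apply, hT c.1 c.2]
    ring
  zero_mem' := ⟨o, by ext; simp [busemannMap]⟩
  smul_mem' := by
    rintro a _ ⟨x, rfl⟩
    obtain ⟨e, he, rfl, δ, -, h⟩ := hY.exists_line_to_fiber o x
    exact ⟨e (a * δ), by rw [hY.busemannMap_smul he, busemannMap_eq_iff.2 h]⟩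

theorem IsInversive.busemannMap_sub (hY : IsInversive Y) (o : Y) {c : ℝ → Y} (hc : Isometry c)
    (s t : ℝ) : ∃ e : ℝ → Y, Isometry e ∧ e 0 = o ∧ ∃ u, 0 ≤ u ∧ u ^ 2 = (s - t) ^ 2 ∧
      busemannMap o (c s) - busemannMap o (c t) = busemannMap o (e u) := by
  obtain ⟨T, hT, hTb⟩ := hY.exists_shift (c t) o
  have key : ∀ x, busemannMap o x - busemannMap o (c t) = busemannMap o (T x) := by
    intro x
    ext d
    simp only [busemannMap, Pi.sub_apply, hTb d.1 d.2]
    ring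
  rcases le_total t s with h | h
  · refine ⟨fun v => T (c (t + v)), T.isometry.comp (isometry_translate hc t), by simp [hT], s - t,
      sub_nonneg.2 h, rfl, ?_⟩
    simp only [key, add_sub_cancel]
  · refine ⟨fun v => T (c (t + -v)), T.isometry.comp (isometry_reverse (isometry_translate hc t)),
      by simp [hT], t - s, sub_nonneg.2 h, by ring, ?_⟩
    rw [key]
    congr 3
    ring

/-- Busemann functions provide a map to a Euclidean space whose point preimages are the fibers and
which is isometric along all geodesic lines. -/
theorem IsInversive.exists_map_euclideanSpace (hY : IsInversive Y) :
    ∃ k : ℕ, 1 ≤ k ∧ ∃ f : Y → EuclideanSpace ℝ (Fin k), Function.Surjective f ∧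
      (∀ x y, f x = f y ↔ SameFiber x y) ∧
      ∀ c : ℝ → Y, Isometry c → ∀ s t, dist (f (c s)) (f (c t)) = |s - t| := by
  obtain ⟨c₀, hc₀⟩ := hY.exists_line
  set o := c₀ 0 with ho
  set V := hY.busemannSpace o with hV
  let Φ : Y → V := fun x => ⟨busemannMap o x, x, rfl⟩
  have hline : ∀ p : V, ∃ e : ℝ → Y, Isometry e ∧ e 0 = o ∧ ∃ δ, 0 ≤ δ ∧ Φ (e δ) = p := by
    rintro ⟨_, x, rfl⟩
    obtain ⟨e, he, he0, δ, hδ, h⟩ := hY.exists_line_to_fiber o x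
    exact ⟨e, he, he0, δ, hδ, Subtype.ext (busemannMap_eq_iff.2 h)⟩
  choose e he he0 δ hδ heδ using hline
  have hval : ∀ (p : V) (d : ℝ → Y) (hd : Isometry d), d 0 = o →
      p.1 ⟨d, hd⟩ = δ p * busemann d (e p 1) := by
    intro p d hd hd0
    conv_lhs => rw [← heδ p]
    simp only [Φ, busemannMap]
    rw [← hd0, busemann_zero hd, sub_zero, hY.busemann_ray hd (he p) (hd0.trans (he0 p).symm)]
  have hδ_eq : ∀ (d : ℝ → Y), Isometry d → d 0 = o → ∀ u, 0 ≤ u → δ (Φ (d u)) = u := by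
    intro d hd hd0 u hu
    have hsame : SameFiber (e (Φ (d u)) (δ (Φ (d u)))) (d u) :=
      busemannMap_eq_iff.1 (congrArg Subtype.val (heδ (Φ (d u))))
    have h1 := abs_sub_le_dist_of_sameFiber hd (s := 0) (t := u) (x := o)
      (by rw [hd0]; exact fun _ _ => rfl) hsame
    have h2 := abs_sub_le_dist_of_sameFiber (he (Φ (d u))) (s := 0) (x := o)
      (by rw [he0]; exact fun _ _ => rfl) hsame.symm
    rw [← he0 (Φ (d u)), dist_line (he _)] at h1
    rw [← hd0, dist_line hd] at h2
    simp only [zero_sub, abs_neg, abs_of_nonneg hu, abs_of_nonneg (hδ _)] at h1 h2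
    exact le_antisymm h2 h1
  let B : V → V → ℝ := fun p q => -δ q * p.1 ⟨e q, he q⟩
  have hBself : ∀ p, B p p = δ p ^ 2 := by
    intro p
    simp only [B]
    rw [hval p _ (he p) (he0 p), busemann_line (he p)]
    ring
  have hBsub : ∀ c : ℝ → Y, Isometry c → ∀ s t, B (Φ (c s) - Φ (c t)) (Φ (c s) - Φ (c t)) =
      (s - t) ^ 2 := by
    intro c hc s t
    obtain ⟨d, hd, hd0, u, hu, hus, h⟩ := hY.busemannMap_sub o hc s t
    have : Φ (c s) - Φ (c t) = Φ (d u) := Subtype.ext h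
    rw [this, hBself, hδ_eq d hd hd0 u hu, hus]
  obtain ⟨k, hk, f, hf⟩ := exists_linearEquiv_euclideanSpace B
    (fun p q => by
      simp only [B]
      rw [hval p _ (he q) (he0 q), hval q _ (he p) (he0 p),
        hY.busemann_symm (he q) (he p) ((he0 q).trans (he0 p).symm)]
      ring)
    (fun p p' q => by
      simp only [B, Submodule.coe_add, Pi.add_apply]
      ring)
    (fun a p q => by
      simp only [B, Submodule.coe_smul, Pi.smul_apply, smul_eq_mul]
      ring)
    (fun p => by rw [hBself]; positivity)
    (fun p hp => by
      rw [hBself, sq_eq_zero_iff] at hp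
      rw [← heδ p, hp, he0]
      ext d
      simp [Φ, busemannMap])
    Φ (fun x y => by
      obtain ⟨d, hd, rfl, u, hu, h⟩ := hY.exists_line_to_fiber x y
      have h1 : Φ (d u) = Φ y := Subtype.ext (busemannMap_eq_iff.2 h)
      have h2 :=
        abs_sub_le_dist_of_sameFiber hd (s := 0) (t := u) (x := d 0) (fun _ _ => rfl) h.symm
      rw [← h1, hBsub d hd, ← sq_abs]
      gcongr) o
    (fun p => ⟨e p (δ p), heδ p, by
      rw [hBself, ← he0 p, dist_line (he p), sq_abs, sub_zero]⟩)
    ⟨Φ (c₀ 1), fun h => by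
      have h1 := hδ_eq c₀ hc₀ rfl 1 zero_le_one
      have h2 := hBsub c₀ hc₀ 1 0
      have h3 : Φ (c₀ 0) = 0 := by
        ext d
        simp [Φ, busemannMap, ho]
      rw [h3, sub_zero, hBself, h] at h2
      have h4 := hδ_eq c₀ hc₀ rfl 0 le_rfl
      rw [h3] at h4
      rw [h4] at h2
      norm_num at h2⟩
  refine ⟨k, hk, fun x => f (Φ x), f.surjective.comp fun p => ⟨_, heδ p⟩, fun x y => ?_,
    fun c hc s t => ?_⟩
  · rw [f.injective.eq_iff, Subtype.ext_iff]
    exact busemannMap_eq_iff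
  · rw [dist_eq_norm, ← map_sub, ← abs_of_nonneg (norm_nonneg _), ← sq_eq_sq_iff_abs_eq_abs, hf,
      hBsub c hc]

end Euclidean

section Circles

variable {X : Type*} [MetricSpace X]

/-- Ptolemy circles of a metric space. -/
def IsMetricPtolemyCircle (σ : Set X) : Prop :=
  Nonempty (σ ≃ₜ Metric.sphere (0 : ℂ) 1) ∧
  ∀ x ∈ σ, ∀ y ∈ σ, ∀ z ∈ σ, ∀ u ∈ σ, x ≠ y → x ≠ z → x ≠ u → y ≠ z → y ≠ u → z ≠ u →
    u ∉ connectedComponentIn (σ \ {x, z}) y →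
    dist x z * dist y u = dist x y * dist z u + dist x u * dist y z

/-- Parametrizations of Ptolemy circles which become geodesic after sending the point `a` of the
circle to infinity. -/
def IsCircleParam (a : X) (c : ℝ → X) : Prop :=
  (∀ s, c s ≠ a) ∧ ∀ s t, dist (c s) (c t) = |s - t| * (dist (c s) a * dist (c t) a)

theorem exists_onePoint_homeo (v : Metric.sphere (0 : ℂ) 1) :
    ∃ h : OnePoint ℝ ≃ₜ Metric.sphere (0 : ℂ) 1, h OnePoint.infty = v := by
  have hv : ‖(v : ℂ)‖ = 1 := mem_sphere_zero_iff_norm.1 v.2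
  have hv0 : (v : ℂ) ≠ 0 := norm_ne_zero_iff.1 (by rw [hv]; exact one_ne_zero)
  have : Fact (Module.finrank ℝ ℂ = 1 + 1) := ⟨Complex.finrank_real_complex⟩
  have h1 : Module.finrank ℝ ℝ = Module.finrank ℝ (Submodule.span ℝ {(v : ℂ)})ᗮ := by
    rw [Submodule.finrank_orthogonal_span_singleton (n := 1) hv0, Module.finrank_self]
  let e : ℝ ≃ₜ (Submodule.span ℝ {(v : ℂ)})ᗮ :=
    (FiniteDimensional.nonempty_continuousLinearEquiv_of_finrank_eq h1).some.toHomeomorph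
  exact ⟨e.onePointCongr.trans (onePointHyperplaneHomeoUnitSphere hv), rfl⟩

theorem not_mem_connectedComponentIn_of_lt {σ : Set X} {a : X} (g : OnePoint ℝ ≃ₜ σ)
    (ha : (g OnePoint.infty : X) = a) {r s t : ℝ} (hrs : r < s) (hst : s < t) :
    a ∉ connectedComponentIn (σ \ {(g r : X), (g t : X)}) (g s : X) := by
  intro hmem
  set C := connectedComponentIn (σ \ {(g r : X), (g t : X)}) (g s : X) with hC
  have hCsub : C ⊆ σ \ {(g r : X), (g t : X)} := connectedComponentIn_subset _ _
  have hpre : IsPreconnected (g ⁻¹' ((↑) ⁻¹' C : Set σ)) := by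
    rw [← g.isInducing.isPreconnected_image, g.image_preimage,
      ← Topology.IsInducing.subtypeVal.isPreconnected_image, Subtype.image_preimage_coe,
      Set.inter_eq_right.2 (hCsub.trans Set.sdiff_subset)]
    exact isPreconnected_connectedComponentIn
  have hs : (s : OnePoint ℝ) ∈ g ⁻¹' ((↑) ⁻¹' C : Set σ) := by
    refine mem_connectedComponentIn ⟨(g s).2, ?_⟩
    simp only [Set.mem_insert_iff, Set.mem_singleton_iff, not_or]
    constructor
    · intro h
      have := OnePoint.coe_injective (g.injective (Subtype.ext h))
      exact hrs.ne' this
    · intro h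
      have := OnePoint.coe_injective (g.injective (Subtype.ext h))
      exact hst.ne this
  have hinf : OnePoint.infty ∈ g ⁻¹' ((↑) ⁻¹' C : Set σ) := by
    change (g OnePoint.infty : X) ∈ C
    rwa [ha]
  have hr : (r : OnePoint ℝ) ∉ g ⁻¹' ((↑) ⁻¹' C : Set σ) := fun h => (hCsub h).2 (by simp)
  have ht : (t : OnePoint ℝ) ∉ g ⁻¹' ((↑) ⁻¹' C : Set σ) := fun h => (hCsub h).2 (by simp)
  have hopen : IsOpen ((↑) '' Set.Ioo r t : Set (OnePoint ℝ)) :=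
    OnePoint.isOpenEmbedding_coe.isOpenMap _ isOpen_Ioo
  have hclosed : IsOpen ((↑) '' Set.Icc r t : Set (OnePoint ℝ))ᶜ :=
    ((isCompact_Icc.image OnePoint.continuous_coe).isClosed).isOpen_compl
  obtain ⟨p, -, ⟨q, hq, rfl⟩, hp⟩ := hpre _ _ hopen hclosed (by
    intro p hp
    by_cases h : p ∈ ((↑) '' Set.Icc r t : Set (OnePoint ℝ))
    · obtain ⟨q, hq, rfl⟩ := h
      refine Or.inl ⟨q, ⟨lt_of_le_of_ne hq.1 ?_, lt_of_le_of_ne hq.2 ?_⟩, rfl⟩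
      · rintro rfl; exact hr hp
      · rintro rfl; exact ht hp
    · exact Or.inr h) ⟨s, hs, s, ⟨hrs, hst⟩, rfl⟩ ⟨_, hinf, by simp⟩
  exact hp ⟨q, Set.Ioo_subset_Icc_self hq, rfl⟩

theorem IsMetricPtolemyCircle.exists_param {σ : Set X} (hσ : IsMetricPtolemyCircle σ) {a : X}
    (ha : a ∈ σ) : ∃ c : ℝ → X, IsCircleParam a c ∧ Set.range c = σ \ {a} := by
  obtain ⟨⟨h⟩, hP⟩ := hσ
  obtain ⟨h', hh'⟩ := exists_onePoint_homeo (h ⟨a, ha⟩)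
  set g : OnePoint ℝ ≃ₜ σ := h'.trans h.symm with hg
  have hga : (g OnePoint.infty : X) = a := by simp [hg, hh']
  set u : ℝ → X := fun t => g t with hu
  have huσ : ∀ t, u t ∈ σ := fun t => (g t).2
  have huinj : Function.Injective u := fun s t hst =>
    OnePoint.coe_injective (g.injective (Subtype.ext hst))
  have hua : ∀ t, u t ≠ a := fun t h => by
    rw [← hga] at h
    exact OnePoint.coe_ne_infty t (g.injective (Subtype.ext h))
  have huc : Continuous u :=
    continuous_subtype_val.comp (g.continuous.comp OnePoint.continuous_coe)
  have hulim : Tendsto u (cocompact ℝ) (𝓝 a) := by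
    have h1 := OnePoint.tendsto_coe_infty (X := ℝ)
    rw [coclosedCompact_eq_cocompact] at h1
    have h2 : Tendsto u (cocompact ℝ) (𝓝 (g OnePoint.infty : X)) :=
      ((continuous_subtype_val.comp g.continuous).tendsto OnePoint.infty).comp h1
    rwa [hga] at h2
  have hrange : Set.range u = σ \ {a} := by
    ext x
    constructor
    · rintro ⟨t, rfl⟩
      exact ⟨huσ t, hua t⟩
    · rintro ⟨hx, hxa⟩
      obtain ⟨p, hp⟩ := g.surjective ⟨x, hx⟩
      induction p using OnePoint.rec with
      | infty => exact absurd (show x = a by rw [← hga, hp]) hxa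
      | coe t => exact ⟨t, by simp only [hu, hp]⟩
  have hpos : ∀ t, 0 < dist (u t) a := fun t => dist_pos.2 (hua t)
  set K : ℝ → ℝ → ℝ := fun s t => dist (u s) (u t) / (dist (u s) a * dist (u t) a) with hK
  have hKsymm : ∀ s t, K s t = K t s := fun s t => by
    simp only [hK, dist_comm (u s) (u t), mul_comm]
  have hKself : ∀ s, K s s = 0 := fun s => by simp [hK]
  have hKadd : ∀ {r s t}, r ≤ s → s ≤ t → K r t = K r s + K s t := by
    intro r s t hrs hst
    rcases hrs.eq_or_lt with rfl | hrs
    · rw [hKself, zero_add]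
    rcases hst.eq_or_lt with rfl | hst
    · rw [hKself, add_zero]
    have h1 := hP (u r) (huσ r) (u s) (huσ s) (u t) (huσ t) a ha
      (fun h => hrs.ne (huinj h)) (fun h => (hrs.trans hst).ne (huinj h)) (hua r)
      (fun h => hst.ne (huinj h)) (hua s) (hua t)
      (not_mem_connectedComponentIn_of_lt g hga hrs hst)
    have := hpos r
    have := hpos s
    have := hpos t
    simp only [hK]
    field_simp
    linarith
  have hKpos : ∀ {s t}, s ≠ t → 0 < K s t := fun {s t} hst =>
    div_pos (dist_pos.2 fun h => hst (huinj h)) (mul_pos (hpos s) (hpos t))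
  set L : ℝ → ℝ := fun t => if 0 ≤ t then K 0 t else -K 0 t with hL
  have hLsub : ∀ {s t}, s ≤ t → L t - L s = K s t := by
    intro s t hst
    simp only [hL]
    split_ifs with h1 h2 h2
    · linarith [hKadd h2 hst]
    · rw [hKsymm 0 s]
      linarith [hKadd (not_le.1 h2).le h1]
    · exact absurd (h2.trans hst) h1
    · rw [hKsymm 0 s, hKsymm 0 t]
      linarith [hKadd hst (not_le.1 h1).le]
  have hLabs : ∀ s t, K s t = |L s - L t| := by
    have hK0 : ∀ s t, 0 ≤ K s t := fun s t => by positivity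
    intro s t
    rcases le_total s t with h | h
    · rw [abs_sub_comm, hLsub h, abs_of_nonneg (hK0 _ _)]
    · rw [hLsub h, abs_of_nonneg (hK0 _ _), hKsymm]
  have hLmono : StrictMono L := fun s t hst => by
    have := hKpos hst.ne
    rw [← hLsub hst.le] at this
    linarith
  have hKc : ∀ s, Continuous fun t => K t s := fun s =>
    (huc.dist continuous_const).div₀ ((huc.dist continuous_const).mul continuous_const)
      fun t => (mul_pos (hpos t) (hpos s)).ne'
  have hLc : Continuous L := by
    rw [continuous_iff_continuousAt]
    intro s
    rw [ContinuousAt, tendsto_iff_dist_tendsto_zero]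
    have h1 := (hKc s).tendsto s
    rw [hKself] at h1
    exact h1.congr fun t => by rw [hLabs, Real.dist_eq]
  have hKtop : Tendsto (fun t => K 0 t) (cocompact ℝ) atTop := by
    have h1 : Tendsto (fun t => dist (u t) a) (cocompact ℝ) (𝓝[>] 0) := by
      refine tendsto_nhdsWithin_iff.2 ⟨?_, Eventually.of_forall hpos⟩
      simpa using hulim.dist (tendsto_const_nhds (x := a))
    have h2 : Tendsto (fun t => dist (u 0) (u t) / dist (u 0) a) (cocompact ℝ) (𝓝 1) := by
      have := (tendsto_const_nhds (x := u 0)).dist hulim |>.div_const (dist (u 0) a)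
      rwa [div_self (hpos 0).ne'] at this
    refine (h2.pos_mul_atTop one_pos h1.inv_tendsto_nhdsGT_zero).congr fun t => ?_
    simp only [hK, Pi.inv_apply]
    rw [div_mul_eq_div_div, ← div_eq_mul_inv]
  rw [cocompact_eq_atBot_atTop] at hKtop
  have hLtop : Tendsto L atTop atTop := by
    refine (hKtop.mono_left le_sup_right).congr' ?_
    filter_upwards [eventually_ge_atTop 0] with t ht
    simp only [hL, if_pos ht]
  have hLbot : Tendsto L atBot atBot := by
    refine (tendsto_neg_atTop_atBot.comp (hKtop.mono_left le_sup_left)).congr' ?_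
    filter_upwards [eventually_lt_atBot 0] with t ht
    simp only [hL, if_neg (not_le.2 ht), Function.comp]
  obtain ⟨R, hR⟩ := (hLc.surjective hLtop hLbot).hasRightInverse
  have hRL : ∀ t, R (L t) = t := fun t => hLmono.injective (hR (L t))
  refine ⟨fun s => u (R s), ⟨fun s => hua _, fun s t => ?_⟩, ?_⟩
  · have h1 := hLabs (R s) (R t)
    rw [hR, hR] at h1
    rw [← h1]
    simp only [hK]
    have := hpos (R s)
    have := hpos (R t)
    field_simp
  · rw [← hrange]
    ext x
    constructor
    · rintro ⟨s, rfl⟩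
      exact ⟨_, rfl⟩
    · rintro ⟨t, rfl⟩
      exact ⟨L t, by simp only [hRL]⟩

namespace IsCircleParam

variable {a : X} {c : ℝ → X}

theorem dist_pos (hc : IsCircleParam a c) (s : ℝ) : 0 < dist (c s) a :=
  _root_.dist_pos.2 (hc.1 s)

theorem injective (hc : IsCircleParam a c) : Function.Injective c := by
  intro s t h
  have h1 := hc.2 s t
  rw [h, dist_self] at h1
  have := hc.dist_pos t
  rcases mul_eq_zero.1 h1.symm with h2 | h2
  · exact sub_eq_zero.1 (abs_eq_zero.1 h2)
  · exact absurd h2 (mul_pos this this).ne'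

variable [CompactSpace X]

theorem continuous (hc : IsCircleParam a c) : Continuous c := by
  set D := Metric.diam (Set.univ : Set X)
  have hD : ∀ x y : X, dist x y ≤ D := fun x y =>
    Metric.dist_le_diam_of_mem isCompact_univ.isBounded (Set.mem_univ x) (Set.mem_univ y)
  refine (LipschitzWith.of_dist_le_mul (K := (D * D).toNNReal) fun s t => ?_).continuous
  rw [Real.coe_toNNReal _ (mul_self_nonneg D), hc.2 s t, mul_comm, Real.dist_eq]
  gcongr
  · exact hD _ _
  · exact hD _ _

theorem tendsto_cocompact (hc : IsCircleParam a c) : Tendsto c (cocompact ℝ) (𝓝 a) := by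
  set D := Metric.diam (Set.univ : Set X)
  have hD : ∀ x y : X, dist x y ≤ D := fun x y =>
    Metric.dist_le_diam_of_mem isCompact_univ.isBounded (Set.mem_univ x) (Set.mem_univ y)
  rw [tendsto_iff_dist_tendsto_zero]
  have h0 : Tendsto (fun t : ℝ => D / dist (c 0) a / ‖t‖) (cocompact ℝ) (𝓝 0) :=
    (tendsto_norm_cocompact_atTop (E := ℝ)).const_div_atTop _
  refine squeeze_zero' (Eventually.of_forall fun _ => dist_nonneg) ?_ h0
  have hne : ∀ᶠ t : ℝ in cocompact ℝ, t ≠ 0 :=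
    (isCompact_singleton (x := (0 : ℝ))).compl_mem_cocompact
  filter_upwards [hne] with t ht
  have h1 := hc.2 t 0
  have h2 := hc.dist_pos 0
  rw [sub_zero] at h1
  rw [Real.norm_eq_abs, div_div, le_div_iff₀ (mul_pos h2 (abs_pos.2 ht))]
  calc dist (c t) a * (dist (c 0) a * |t|) = dist (c t) (c 0) := by rw [h1]; ring
    _ ≤ D := hD _ _

theorem isPreconnected_insert (hc : IsCircleParam a c) {A : Set ℝ} (hA : IsPreconnected A)
    {l : Filter ℝ} [l.NeBot] (hl : l ≤ cocompact ℝ) (hAl : A ∈ l) :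
    IsPreconnected (insert a (c '' A)) := by
  refine (hA.image c hc.continuous.continuousOn).subset_closure (Set.subset_insert _ _)
    (Set.insert_subset ?_ subset_closure)
  refine mem_closure_of_tendsto (hc.tendsto_cocompact.mono_left hl) ?_
  filter_upwards [hAl] with t ht using ⟨t, ht, rfl⟩

theorem isPreconnected_insert_pos (hc : IsCircleParam a c) (p q : ℝ) :
    IsPreconnected (insert a (c '' {t | 0 < (t - p) * (t - q)})) := by
  have h1 : IsPreconnected (insert a (c '' Set.Iio (min p q))) :=
    hc.isPreconnected_insert isPreconnected_Iio atBot_le_cocompact (Iio_mem_atBot _)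
  have h2 : IsPreconnected (insert a (c '' Set.Ioi (max p q))) :=
    hc.isPreconnected_insert isPreconnected_Ioi atTop_le_cocompact (Ioi_mem_atTop _)
  have h3 := IsPreconnected.union a (Set.mem_insert _ _) (Set.mem_insert _ _) h1 h2
  rw [← Set.insert_union_distrib, ← Set.image_union] at h3
  convert h3 using 4
  ext t
  simp only [mul_pos_iff, Set.mem_ofPred_eq, Set.mem_union, Set.mem_Iio, Set.mem_Ioi, lt_min_iff,
    max_lt_iff, sub_pos, sub_neg]
  tauto

theorem isMetricPtolemyCircle (hc : IsCircleParam a c) :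
    IsMetricPtolemyCircle (insert a (Set.range c)) := by
  constructor
  · set G : OnePoint ℝ → X := fun p => p.elim a c with hG
    have hGc : Continuous G := by
      rw [OnePoint.continuous_iff, coclosedCompact_eq_cocompact]
      exact ⟨hc.tendsto_cocompact, hc.continuous⟩
    have hGi : Function.Injective G := by
      intro p q h
      induction p using OnePoint.rec with
      | infty =>
        induction q using OnePoint.rec with
        | infty => rfl
        | coe t => exact absurd h.symm (hc.1 t)
      | coe s =>
        induction q using OnePoint.rec with
        | infty => exact absurd h (hc.1 s)
        | coe t => rw [hc.injective h]
    have hrange : Set.range G = insert a (Set.range c) := by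
      ext x
      constructor
      · rintro ⟨p, rfl⟩
        induction p using OnePoint.rec with
        | infty => exact Or.inl rfl
        | coe t => exact Or.inr ⟨t, rfl⟩
      · rintro (rfl | ⟨t, rfl⟩)
        · exact ⟨OnePoint.infty, rfl⟩
        · exact ⟨(t : OnePoint ℝ), rfl⟩
    obtain ⟨h, -⟩ := exists_onePoint_homeo ⟨1, by simp⟩
    exact ⟨(Homeomorph.setCongr hrange.symm).trans
      ((hGc.isClosedEmbedding hGi).isEmbedding.toHomeomorph.symm.trans h)⟩
  · intro x hx y hy z hz u hu hxy hxz hxu hyz hyu hzu hsep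
    have key : ∀ T : Set X, IsPreconnected T → T ⊆ insert a (Set.range c) → y ∈ T → u ∈ T →
        x ∉ T → z ∉ T → False := by
      intro T hT hTσ hyT huT hxT hzT
      have hT' : T ⊆ insert a (Set.range c) \ {x, z} := fun p hp =>
        ⟨hTσ hp, by rintro (rfl | rfl) <;> contradiction⟩
      exact hsep (hT.subset_connectedComponentIn hyT hT' huT)
    have hsub : ∀ A : Set ℝ, c '' A ⊆ insert a (Set.range c) := fun A =>
      (Set.image_subset_range c A).trans (Set.subset_insert _ _)
    have hsub' : ∀ A : Set ℝ, insert a (c '' A) ⊆ insert a (Set.range c) := fun A =>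
      Set.insert_subset_insert (Set.image_subset_range c A)
    have ha : ∀ A : Set ℝ, a ∉ c '' A := by
      rintro A ⟨t, -, h⟩
      exact hc.1 t h
    have hmem : ∀ (A : Set ℝ) (t : ℝ), c t ∈ c '' A ↔ t ∈ A := fun A t =>
      hc.injective.mem_set_image
    have hmem' : ∀ (A : Set ℝ) (t : ℝ), c t ∈ insert a (c '' A) ↔ t ∈ A := fun A t => by
      rw [Set.mem_insert_iff, hmem, or_iff_right (hc.1 t)]
    have hci := hc.continuous
    have hne : ∀ {s t : ℝ}, c s ≠ c t → s ≠ t := fun h h' => h (by rw [h'])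
    have hside : ∀ p q r : ℝ, q ≠ p → r ≠ p → 0 < (q - p) * (r - p) →
        ∃ A : Set ℝ, IsPreconnected A ∧ q ∈ A ∧ r ∈ A ∧ p ∉ A := by
      intro p q r hq hr h
      rcases mul_pos_iff.1 h with ⟨h1, h2⟩ | ⟨h1, h2⟩
      · exact ⟨Set.Ioi p, isPreconnected_Ioi, sub_pos.1 h1, sub_pos.1 h2, lt_irrefl p⟩
      · exact ⟨Set.Iio p, isPreconnected_Iio, sub_neg.1 h1, sub_neg.1 h2, lt_irrefl p⟩
    have habs : ∀ p q : ℝ, p * q ≤ 0 → |p - q| = |p| + |q| := by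
      intro p q h
      have := abs_add_eq_add_abs_iff p (-q)
      rw [← sub_eq_add_neg, abs_neg] at this
      refine this.2 ?_
      rcases mul_nonpos_iff.1 h with h | h
      · exact Or.inl ⟨h.1, neg_nonneg.2 h.2⟩
      · exact Or.inr ⟨h.1, neg_nonpos.2 h.2⟩
    rcases hx with rfl | ⟨x, rfl⟩
    · obtain ⟨y, rfl⟩ := hy.resolve_left hxy.symm
      obtain ⟨z, rfl⟩ := hz.resolve_left hxz.symm
      obtain ⟨u, rfl⟩ := hu.resolve_left hxu.symm
      have h1 : (y - z) * (u - z) ≤ 0 := by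
        by_contra h
        obtain ⟨A, hA, hyA, huA, hzA⟩ :=
          hside z y u (hne hyz) (hne hzu).symm (not_le.1 h)
        exact key _ (hA.image c hci.continuousOn) (hsub _) ((hmem _ _).2 hyA) ((hmem _ _).2 huA)
          (ha _) (fun h => hzA ((hmem _ _).1 h))
      have h2 := habs _ _ h1
      rw [sub_sub_sub_cancel_right] at h2
      rw [hc.2, hc.2, hc.2, dist_comm x, dist_comm x, dist_comm x, h2, abs_sub_comm z u]
      ring
    rcases hz with rfl | ⟨z, rfl⟩
    · obtain ⟨y, rfl⟩ := hy.resolve_left hyz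
      obtain ⟨u, rfl⟩ := hu.resolve_left hzu.symm
      have h1 : (y - x) * (u - x) ≤ 0 := by
        by_contra h
        obtain ⟨A, hA, hyA, huA, hzA⟩ :=
          hside x y u (hne hxy).symm (hne hxu).symm (not_le.1 h)
        exact key _ (hA.image c hci.continuousOn) (hsub _) ((hmem _ _).2 hyA) ((hmem _ _).2 huA)
          (fun h => hzA ((hmem _ _).1 h)) (ha _)
      have h2 := habs _ _ h1
      rw [sub_sub_sub_cancel_right] at h2
      rw [hc.2, hc.2, hc.2, dist_comm z, h2, abs_sub_comm x y, abs_sub_comm x u]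
      ring
    have hxz' := hne hxz
    have hpos : ∀ t, ¬ (t - x) * (t - z) ≤ 0 → t ∈ {t | 0 < (t - x) * (t - z)} :=
      fun t ht => not_le.1 ht
    have hx0 : x ∉ {t | 0 < (t - x) * (t - z)} := by simp
    have hz0 : z ∉ {t | 0 < (t - x) * (t - z)} := by simp
    have hxz0 : ∀ t : ℝ, (t - x) * (t - z) ≤ 0 → |x - z| = |x - t| + |t - z| := by
      intro t ht
      have := habs _ _ ht
      rw [sub_sub_sub_cancel_left] at this
      rw [abs_sub_comm x z, this, abs_sub_comm t x]
    rcases hy with rfl | ⟨y, rfl⟩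
    · obtain ⟨u, rfl⟩ := hu.resolve_left hyu.symm
      have h1 : (u - x) * (u - z) ≤ 0 := by
        by_contra h
        exact key _ (hc.isPreconnected_insert_pos x z) (hsub' _) (Set.mem_insert _ _)
          ((hmem' _ _).2 (hpos u h)) (fun h => hx0 ((hmem' _ _).1 h))
          (fun h => hz0 ((hmem' _ _).1 h))
      rw [hc.2, hc.2, hc.2, hxz0 u h1, dist_comm y, dist_comm y, abs_sub_comm z u]
      ring
    rcases hu with rfl | ⟨u, rfl⟩
    · have h1 : (y - x) * (y - z) ≤ 0 := by
        by_contra h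
        exact key _ (hc.isPreconnected_insert_pos x z) (hsub' _) ((hmem' _ _).2 (hpos y h))
          (Set.mem_insert _ _) (fun h => hx0 ((hmem' _ _).1 h)) (fun h => hz0 ((hmem' _ _).1 h))
      rw [hc.2, hc.2, hc.2, hxz0 y h1]
      ring
    have h1 : ((y - x) * (y - z)) * ((u - x) * (u - z)) ≤ 0 := by
      by_contra h
      rcases mul_pos_iff.1 (not_le.1 h) with ⟨h1, h2⟩ | ⟨h1, h2⟩
      · exact key _ (hc.isPreconnected_insert_pos x z) (hsub' _) ((hmem' _ _).2 h1)
          ((hmem' _ _).2 h2) (fun h => hx0 ((hmem' _ _).1 h)) (fun h => hz0 ((hmem' _ _).1 h))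
      · have h3 : ∀ t, (t - x) * (t - z) < 0 → t ∈ Set.Ioo (min x z) (max x z) := by
          intro t ht
          rcases mul_neg_iff.1 ht with h | h
          · exact ⟨min_lt_of_left_lt (sub_pos.1 h.1), lt_max_of_lt_right (sub_neg.1 h.2)⟩
          · exact ⟨min_lt_of_right_lt (sub_pos.1 h.2), lt_max_of_lt_left (sub_neg.1 h.1)⟩
        refine key _ (isPreconnected_Ioo.image c hci.continuousOn) (hsub _)
          ((hmem _ _).2 (h3 y h1)) ((hmem _ _).2 (h3 u h2)) (fun h => ?_) (fun h => ?_)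
        · have := (hmem _ _).1 h
          rcases le_total x z with h | h <;> simp [h] at this
        · have := (hmem _ _).1 h
          rcases le_total x z with h | h <;> simp [h] at this
    have h2 := habs ((x - y) * (z - u)) (-((x - u) * (y - z))) (by nlinarith)
    rw [abs_neg, abs_mul, abs_mul,
      show (x - y) * (z - u) - -((x - u) * (y - z)) = (x - z) * (y - u) by ring, abs_mul] at h2
    rw [hc.2, hc.2, hc.2, hc.2, hc.2, hc.2]
    linear_combination (dist (c x) a * dist (c z) a * (dist (c y) a * dist (c u) a)) * h2

end IsCircleParam

end Circles

section Chordal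

variable {X : Type*} {S : MobiusStructure X} {d : ExtMetric X}

namespace ExtMetric

theorem fd_self (d : ExtMetric X) (x : X) : d.fd x x = 0 := by
  simp [fd, d.d_self]

theorem fd_symm (d : ExtMetric X) (x y : X) : d.fd x y = d.fd y x := by
  simp only [fd, d.symm x y]

theorem fd_pos (d : ExtMetric X) {x y : X} (h : x ≠ y) : 0 < d.fd x y := by
  unfold fd
  split_ifs with h1
  · exact one_pos
  · exact ENNReal.toReal_pos (d.pos x y h).ne' h1

theorem fd_nonneg (d : ExtMetric X) (x y : X) : 0 ≤ d.fd x y := by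
  rcases eq_or_ne x y with rfl | h
  · exact (d.fd_self x).ge
  · exact (d.fd_pos h).le

theorem fd_eq_toReal {x y : X} (h : d.d x y ≠ ⊤) : d.fd x y = (d.d x y).toReal :=
  if_neg h

theorem d_ne_top {ω x y : X} (hrem : d.rem = some ω) (hx : x ≠ ω) (hy : y ≠ ω) :
    d.d x y ≠ ⊤ := by
  rw [Ne, d.d_eq_top_iff, hrem, Option.some_inj, Option.some_inj]
  rintro ⟨-, h | h⟩
  · exact hx h.symm
  · exact hy h.symm

theorem fd_rem {ω x : X} (hrem : d.rem = some ω) (hx : x ≠ ω) : d.fd x ω = 1 :=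
  if_pos ((d.d_eq_top_iff x ω).2 ⟨hx, Or.inr hrem⟩)

theorem fd_of_ne_rem {ω x y : X} (hrem : d.rem = some ω) (hx : x ≠ ω) (hy : y ≠ ω) :
    d.fd x y = (d.d x y).toReal :=
  fd_eq_toReal (d_ne_top hrem hx hy)

end ExtMetric

theorem admissible_of_ne {x y z u : X} (hxy : x ≠ y) (hzu : z ≠ u) : Admissible x y z u :=
  ⟨fun h => hxy h.1, fun h => hxy h.1, fun h => hzu h.2, fun h => hzu h.2⟩

theorem IsPtolemyStructure.fd_mul_le (hpt : IsPtolemyStructure S) (hd : d ∈ S.M) (x y z u : X) :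
    d.fd x z * d.fd y u ≤ d.fd x y * d.fd z u + d.fd x u * d.fd y z := by
  have h0 := d.fd_nonneg
  rcases eq_or_ne x y with rfl | hxy
  · have := mul_nonneg (h0 x x) (h0 z u)
    linarith [mul_comm (d.fd x z) (d.fd x u)]
  rcases eq_or_ne z u with rfl | hzu
  · have := mul_nonneg (h0 x y) (h0 z z)
    linarith
  exact (hpt d hd x y z u (admissible_of_ne hxy hzu)).2.1

namespace ExtMetric

/-- The reciprocal of the conformal factor of the chordal metric based at `p` and `q`. -/
noncomputable def weight (d : ExtMetric X) (p q x : X) : ℝ :=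
  d.fd x p + d.fd x q

theorem weight_pos (d : ExtMetric X) {p q : X} (hpq : p ≠ q) (x : X) : 0 < d.weight p q x := by
  rcases eq_or_ne x p with rfl | h
  · exact add_pos_of_nonneg_of_pos (d.fd_nonneg _ _) (d.fd_pos hpq)
  · exact add_pos_of_pos_of_nonneg (d.fd_pos h) (d.fd_nonneg _ _)

/-- The chordal distance based at `p` and `q`. -/
noncomputable def chord (d : ExtMetric X) (p q x y : X) : ℝ :=
  d.fd x y / (d.weight p q x * d.weight p q y)

theorem chord_self (d : ExtMetric X) (p q x : X) : d.chord p q x x = 0 := by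
  rw [chord, fd_self, zero_div]

theorem chord_symm (d : ExtMetric X) (p q x y : X) : d.chord p q x y = d.chord p q y x := by
  rw [chord, chord, fd_symm, mul_comm (d.weight p q x)]

theorem chord_pos (d : ExtMetric X) {p q x y : X} (hpq : p ≠ q) (h : x ≠ y) :
    0 < d.chord p q x y :=
  div_pos (d.fd_pos h) (mul_pos (d.weight_pos hpq x) (d.weight_pos hpq y))

theorem chord_triangle (hpt : IsPtolemyStructure S) (hd : d ∈ S.M) {p q : X} (hpq : p ≠ q)
    (x y z : X) : d.chord p q x z ≤ d.chord p q x y + d.chord p q y z := by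
  have hx := d.weight_pos hpq x
  have hy := d.weight_pos hpq y
  have hz := d.weight_pos hpq z
  have h : d.fd x z * d.weight p q y ≤ d.fd x y * d.weight p q z + d.fd y z * d.weight p q x := by
    have h1 := hpt.fd_mul_le hd x y z p
    have h2 := hpt.fd_mul_le hd x y z q
    simp only [weight]
    linarith
  rw [chord, chord, chord, div_add_div _ _ (by positivity) (by positivity),
    div_le_div_iff₀ (by positivity) (by positivity)]
  nlinarith [mul_le_mul_of_nonneg_right h
    (show 0 ≤ d.weight p q x * d.weight p q z * d.weight p q y by positivity)]

/-- The chordal metric based at `p` and `q`, as an extended metric without remote point. -/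
noncomputable def chordal (hpt : IsPtolemyStructure S) (hd : d ∈ S.M) {p q : X} (hpq : p ≠ q) :
    ExtMetric X where
  d x y := ENNReal.ofReal (d.chord p q x y)
  rem := none
  symm x y := by rw [chord_symm]
  d_self x := by rw [chord_self, ENNReal.ofReal_zero]
  pos x y h := ENNReal.ofReal_pos.2 (d.chord_pos hpq h)
  triangle x y z := by
    have h0 : ∀ x y, 0 ≤ d.chord p q x y := fun x y =>
      div_nonneg (d.fd_nonneg x y) (mul_pos (d.weight_pos hpq x) (d.weight_pos hpq y)).le
    rw [← ENNReal.ofReal_add (h0 _ _) (h0 _ _)]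
    exact ENNReal.ofReal_le_ofReal (chord_triangle hpt hd hpq x y z)
  d_eq_top_iff x y := by simp

theorem fd_chordal (hpt : IsPtolemyStructure S) (hd : d ∈ S.M) {p q : X} (hpq : p ≠ q) (x y : X) :
    (chordal hpt hd hpq).fd x y = d.chord p q x y := by
  rw [fd_eq_toReal (show ENNReal.ofReal (d.chord p q x y) ≠ ⊤ from ENNReal.ofReal_ne_top)]
  exact ENNReal.toReal_ofReal
    (div_nonneg (d.fd_nonneg x y) (mul_pos (d.weight_pos hpq x) (d.weight_pos hpq y)).le)

theorem chordal_mem (hpt : IsPtolemyStructure S) (hd : d ∈ S.M) {p q : X} (hpq : p ≠ q) :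
    chordal hpt hd hpq ∈ S.M := by
  refine S.maximal _ fun d' hd' x y z u hadm => (S.compat d hd d' hd' x y z u hadm).trans' ?_
  have hx := d.weight_pos hpq x
  have hy := d.weight_pos hpq y
  have hz := d.weight_pos hpq z
  have hu := d.weight_pos hpq u
  refine ⟨(d.weight p q x * d.weight p q y * d.weight p q z * d.weight p q u)⁻¹, by positivity, ?_⟩
  simp only [crtVec, fd_chordal, chord, Prod.smul_mk, smul_eq_mul, Prod.mk.injEq]
  refine ⟨?_, ?_, ?_⟩ <;> field_simp

end ExtMetric

/-- The distance of `X` is one of the metrics of the Möbius structure `S`, without remote point. -/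
def IsCompatibleMetric [MetricSpace X] (S : MobiusStructure X) : Prop :=
  ∃ d ∈ S.M, d.rem = none ∧ ∀ x y, d.d x y = ENNReal.ofReal (dist x y)

theorem exists_isCompatibleMetric (hpt : IsPtolemyStructure S) (hd : d ∈ S.M) {ω o : X}
    (hrem : d.rem = some ω) (ho : o ≠ ω) :
    ∃ _ : MetricSpace X, IsCompatibleMetric S ∧ ∀ x y, x ≠ ω → y ≠ ω →
      dist x y = (d.d x y).toReal * (dist x ω * dist y ω) := by
  let m : MetricSpace X :=
    { dist := d.chord ω o
      dist_self := d.chord_self ω o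
      dist_comm := d.chord_symm ω o
      dist_triangle := ExtMetric.chord_triangle hpt hd ho.symm
      eq_of_dist_eq_zero := fun {x y} h => by
        by_contra hxy
        exact (d.chord_pos ho.symm hxy).ne' h }
  refine ⟨m, ⟨_, ExtMetric.chordal_mem hpt hd ho.symm, rfl, fun x y => rfl⟩, fun x y hx hy => ?_⟩
  change d.chord ω o x y = _ * (d.chord ω o x ω * d.chord ω o y ω)
  have h1 : d.weight ω o ω = 1 := by
    rw [ExtMetric.weight, ExtMetric.fd_self, ExtMetric.fd_symm, ExtMetric.fd_rem hrem ho, zero_add]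
  rw [ExtMetric.chord, ExtMetric.chord, ExtMetric.chord, ExtMetric.fd_rem hrem hx,
    ExtMetric.fd_rem hrem hy, h1, ExtMetric.fd_of_ne_rem hrem hx hy, mul_one, mul_one,
    one_div_mul_one_div, mul_one_div]

/-- The space `X` punctured at `ω`. -/
@[ext]
structure Punctured (ω : X) where
  /-- The underlying point. -/
  val : X
  property : val ≠ ω

/-- The metric of `X_ω`. -/
noncomputable abbrev ExtMetric.puncturedMetric (d : ExtMetric X) {ω : X} (hrem : d.rem = some ω) :
    MetricSpace (Punctured ω) where
  dist x y := (d.d x.1 y.1).toReal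
  dist_self x := by rw [d.d_self, ENNReal.toReal_zero]
  dist_comm x y := by rw [d.symm]
  dist_triangle x y z := by
    have h1 := ExtMetric.d_ne_top hrem x.2 y.2
    have h2 := ExtMetric.d_ne_top hrem y.2 z.2
    rw [← ENNReal.toReal_add h1 h2]
    exact ENNReal.toReal_mono (ENNReal.add_ne_top.2 ⟨h1, h2⟩) (d.triangle _ _ _)
  eq_of_dist_eq_zero {x y} h := by
    by_contra hxy
    exact (ENNReal.toReal_pos (d.pos x.1 y.1 fun h => hxy (Punctured.ext h)).ne'
      (ExtMetric.d_ne_top hrem x.2 y.2)).ne' h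

end Chordal

section Topology

variable {X : Type*} [MetricSpace X] {S : MobiusStructure X}

theorem topology_eq_of_le {X : Type*} {t t' : TopologicalSpace X} (h : t ≤ t')
    (ht : @CompactSpace X t) (ht' : @T2Space X t') : t = t' := by
  refine le_antisymm h fun s hs => ?_
  have h1 : @IsCompact X t sᶜ :=
    @IsClosed.isCompact X t _ ht ((@isClosed_compl_iff X t s).2 hs)
  have h2 : @IsCompact X t' sᶜ := by
    simpa using @IsCompact.image X X t t' _ id h1 (continuous_id_iff_le.2 h)
  exact (@isClosed_compl_iff X t' s).1 (@IsCompact.isClosed X t' ht' _ h2)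

theorem mobiusTop_eq (hS : IsCompatibleMetric S) (hcomp : MobiusCompact S) :
    mobiusTop S = (UniformSpace.toTopologicalSpace : TopologicalSpace X) := by
  obtain ⟨d, hd, hrem, hdist⟩ := hS
  have hle : mobiusTop S ≤ (UniformSpace.toTopologicalSpace : TopologicalSpace X) := by
    intro s hs
    refine (@isOpen_iff_forall_mem_open X (mobiusTop S) s).2 fun x hx => ?_
    obtain ⟨r, hr, hrs⟩ := Metric.isOpen_iff.1 hs x hx
    refine ⟨Metric.ball x r, hrs, TopologicalSpace.isOpen_generateFrom_of_mem
      ⟨d, hd, x, by simp [hrem], ENNReal.ofReal r, ENNReal.ofReal_pos.2 hr, ENNReal.ofReal_ne_top,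
        Or.inl ?_⟩, Metric.mem_ball_self hr⟩
    ext y
    simp only [Metric.mem_ball, Set.mem_ofPred_eq, hdist, ENNReal.ofReal_lt_ofReal_iff hr]
  exact topology_eq_of_le hle hcomp inferInstance

theorem isPtolemyCircle_iff (hS : IsCompatibleMetric S) (hcomp : MobiusCompact S) {σ : Set X} :
    IsPtolemyCircle S σ ↔ IsMetricPtolemyCircle σ := by
  have htop := mobiusTop_eq hS hcomp
  obtain ⟨d, hd, -, hdist⟩ := hS
  have hfd : ∀ x y, d.fd x y = dist x y := fun x y => by
    rw [ExtMetric.fd_eq_toReal (by rw [hdist]; exact ENNReal.ofReal_ne_top), hdist,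
      ENNReal.toReal_ofReal dist_nonneg]
  unfold IsPtolemyCircle HomeoToCircle SeparatesIn mobiusCCIn
  rw [htop]
  refine and_congr Iff.rfl ⟨fun h x hx y hy z hz u hu hxy hxz hxu hyz hyu hzu hsep => ?_,
    fun h d' hd' x hx y hy z hz u hu hxy hxz hxu hyz hyu hzu hsep => ?_⟩
  · have := h d hd x hx y hy z hz u hu hxy hxz hxu hyz hyu hzu hsep
    simp only [hdist] at this
    rw [← ENNReal.ofReal_mul dist_nonneg, ← ENNReal.ofReal_mul dist_nonneg,
      ← ENNReal.ofReal_mul dist_nonneg, ← ENNReal.ofReal_add (by positivity) (by positivity),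
      ENNReal.ofReal_eq_ofReal_iff (by positivity) (by positivity)] at this
    exact this
  · have h1 := h x hx y hy z hz u hu hxy hxz hxu hyz hyu hzu hsep
    have hpos : ∀ {p q : X}, p ≠ q → d'.d p q ≠ 0 := fun {p q} h => (d'.pos p q h).ne'
    have htop' : ∀ {p q : X}, p ≠ q → d'.rem = some p → d'.d p q = ⊤ := fun {p q} h h' =>
      (d'.d_eq_top_iff p q).2 ⟨h, Or.inl h'⟩
    have htop'' : ∀ {p q : X}, p ≠ q → d'.rem = some q → d'.d p q = ⊤ := fun {p q} h h' =>
      (d'.d_eq_top_iff p q).2 ⟨h, Or.inr h'⟩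
    by_cases hx' : d'.rem = some x
    · rw [htop' hxz hx', htop' hxy hx', ENNReal.top_mul (hpos hyu), ENNReal.top_mul (hpos hzu),
        top_add]
    by_cases hy' : d'.rem = some y
    · rw [htop' hyu hy', htop'' hxy hy', ENNReal.mul_top (hpos hxz), ENNReal.top_mul (hpos hzu),
        top_add]
    by_cases hz' : d'.rem = some z
    · rw [htop'' hxz hz', htop' hzu hz', ENNReal.top_mul (hpos hyu), ENNReal.mul_top (hpos hxy),
        top_add]
    by_cases hu' : d'.rem = some u
    · rw [htop'' hyu hu', htop'' hzu hu', ENNReal.mul_top (hpos hxz), ENNReal.mul_top (hpos hxy),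
        top_add]
    have hfin : ∀ p q, d'.rem ≠ some p → d'.rem ≠ some q → d'.d p q = ENNReal.ofReal (d'.fd p q) :=
      fun p q hp hq => by
        have : d'.d p q ≠ ⊤ := by
          rw [Ne, d'.d_eq_top_iff]
          tauto
        rw [ExtMetric.fd_eq_toReal this, ENNReal.ofReal_toReal this]
    have h0 := d'.fd_nonneg
    rw [hfin x z hx' hz', hfin y u hy' hu', hfin x y hx' hy', hfin z u hz' hu', hfin x u hx' hu',
      hfin y z hy' hz', ← ENNReal.ofReal_mul (h0 _ _), ← ENNReal.ofReal_mul (h0 _ _),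
      ← ENNReal.ofReal_mul (h0 _ _),
      ← ENNReal.ofReal_add (mul_nonneg (h0 _ _) (h0 _ _)) (mul_nonneg (h0 _ _) (h0 _ _))]
    obtain ⟨l, hl, h2⟩ := S.compat d hd d' hd' x y z u (admissible_of_ne hxy hzu)
    simp only [crtVec, hfd, Prod.smul_mk, smul_eq_mul, Prod.mk.injEq] at h2
    rw [h2.1, h2.2.1, h2.2.2, h1, mul_add]

end Topology

section Punctured

variable {X : Type*} [MetricSpace X] {ω : X} [MetricSpace (Punctured ω)]

/-- The distance of `X ∖ {ω}` is obtained from the distance of `X` by sending `ω` to infinity. -/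
def IsInvertedDist (ω : X) [MetricSpace (Punctured ω)] : Prop :=
  ∀ x y : Punctured ω, dist x.1 y.1 = dist x y * (dist x.1 ω * dist y.1 ω)

theorem IsInvertedDist.isometry_iff (h : IsInvertedDist ω) {c : ℝ → Punctured ω} :
    Isometry c ↔ IsCircleParam ω fun t => (c t).1 := by
  have hpos : ∀ x : Punctured ω, 0 < dist x.1 ω := fun x => dist_pos.2 x.2
  constructor
  · intro hc
    exact ⟨fun s => (c s).2, fun s t => by rw [h, dist_line hc]⟩
  · intro hc
    refine isometry_of_dist fun s t => ?_
    have h1 := h (c s) (c t)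
    rw [hc.2 s t] at h1
    exact (mul_right_cancel₀ (mul_pos (hpos _) (hpos _)).ne' h1).symm

theorem IsInvertedDist.exists_isometry (h : IsInvertedDist ω) {c : ℝ → X}
    (hc : IsCircleParam ω c) : ∃ e : ℝ → Punctured ω, Isometry e ∧ ∀ t, (e t).1 = c t :=
  ⟨fun t => ⟨c t, hc.1 t⟩, h.isometry_iff.2 hc, fun _ => rfl⟩

theorem IsInvertedDist.properSpace [CompactSpace X] (h : IsInvertedDist ω) :
    ProperSpace (Punctured ω) := by
  have hpos : ∀ x : Punctured ω, 0 < dist x.1 ω := fun x => dist_pos.2 x.2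
  refine ⟨fun p R => IsSeqCompact.isCompact fun u hu => ?_⟩
  obtain ⟨q, φ, hφ, hq⟩ := CompactSpace.tendsto_subseq fun n => (u n).1
  have hp := hpos p
  have hR : 0 ≤ R := dist_nonneg.trans (hu 0)
  have hle : dist p.1 ω / (1 + R * dist p.1 ω) ≤ dist q ω := by
    refine ge_of_tendsto (hq.dist tendsto_const_nhds) (Eventually.of_forall fun n => ?_)
    have h1 := dist_triangle p.1 (u (φ n)).1 ω
    have h2 : dist p.1 (u (φ n)).1 ≤ R * (dist p.1 ω * dist (u (φ n)).1 ω) := by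
      rw [h]
      have h3 : dist p (u (φ n)) ≤ R := by
        rw [dist_comm]
        exact hu (φ n)
      exact mul_le_mul_of_nonneg_right h3 (by positivity)
    rw [div_le_iff₀ (by positivity)]
    simp only [Function.comp]
    linarith
  have hqω : q ≠ ω := by
    have : 0 < dist q ω := lt_of_lt_of_le (by positivity) hle
    exact dist_pos.1 this
  have hlim : Tendsto (u ∘ φ) atTop (𝓝 (⟨q, hqω⟩ : Punctured ω)) := by
    rw [tendsto_iff_dist_tendsto_zero]
    have hd := dist_pos.2 hqω
    have h1 : Tendsto (fun n => dist (u (φ n)).1 q / (dist (u (φ n)).1 ω * dist q ω)) atTop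
        (𝓝 (dist q q / (dist q ω * dist q ω))) :=
      (hq.dist tendsto_const_nhds).div ((hq.dist tendsto_const_nhds).mul_const _)
        (mul_pos hd hd).ne'
    rw [dist_self, zero_div] at h1
    refine h1.congr fun n => ?_
    have h2 := h (u (φ n)) ⟨q, hqω⟩
    rw [div_eq_iff (mul_pos (hpos _) hd).ne']
    exact h2
  exact ⟨⟨q, hqω⟩, Metric.isClosed_closedBall.mem_of_tendsto hlim
    (Eventually.of_forall fun n => hu (φ n)), φ, hφ, hlim⟩

variable [CompactSpace X] {S : MobiusStructure X} {d : ExtMetric X}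

theorem exists_punctured_inversion (hcirc : ∀ σ, IsPtolemyCircle S σ ↔ IsMetricPtolemyCircle σ)
    (h : IsInvertedDist ω) (hI : PropertyI S) (hd : d ∈ S.M) (hrem : d.rem = some ω)
    (hdist : ∀ x y : Punctured ω, dist x y = (d.d x.1 y.1).toReal) (x : Punctured ω) {r : ℝ}
    (hr : 0 < r) (hy : ∃ y, dist y x = r) : ∃ φ : Punctured ω → Punctured ω,
      (∀ y, y ≠ x → φ y ≠ x ∧ φ (φ y) = y) ∧
      (∀ y z, y ≠ x → z ≠ x → dist (φ y) (φ z) = r ^ 2 * dist y z / (dist y x * dist z x)) ∧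
      (∀ y, y ≠ x → dist (φ y) x = r ^ 2 / dist y x) ∧
      ∀ c : ℝ → Punctured ω, Isometry c → c 0 = x → ∀ t, t ≠ 0 → φ (c t) = c (-(r ^ 2 / t)) := by
  classical
  obtain ⟨y₀, hy₀⟩ := hy
  have hfd : ∀ y z : Punctured ω, d.fd y.1 z.1 = dist y z := fun y z => by
    rw [hdist, ExtMetric.fd_of_ne_rem hrem y.2 z.2]
  have hfdω : ∀ y : Punctured ω, d.fd y.1 ω = 1 := fun y => ExtMetric.fd_rem hrem y.2
  have hfdω' : ∀ y : Punctured ω, d.fd ω y.1 = 1 := fun y => by rw [ExtMetric.fd_symm, hfdω]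
  have hsph : ∀ y : Punctured ω, d.d y.1 x.1 = ENNReal.ofReal r ↔ dist y x = r := by
    intro y
    rw [hdist, ← ENNReal.toReal_eq_toReal_iff' (ExtMetric.d_ne_top hrem y.2 x.2)
      ENNReal.ofReal_ne_top, ENNReal.toReal_ofReal hr.le]
  obtain ⟨ψ, ⟨⟨-, hcrt⟩, hinv, hfix, hψx, hψsph, hψσ⟩, -⟩ := hI x.1 ω x.2 _
    ⟨d, hd, hrem, ENNReal.ofReal r, ENNReal.ofReal_pos.2 hr, ENNReal.ofReal_ne_top, rfl⟩
  have hψω : ψ ω = x.1 := by simpa only [hψx] using hinv x.1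
  have hne : ∀ y : Punctured ω, y ≠ x → ψ y.1 ≠ ω := fun y hy h =>
    hy (Punctured.ext (hinv.injective (h.trans hψx.symm)))
  set φ : Punctured ω → Punctured ω := fun y => if hy : y = x then x else ⟨ψ y.1, hne y hy⟩ with hφ
  have hφval : ∀ y, y ≠ x → (φ y).1 = ψ y.1 := fun y hy => by simp only [hφ, dif_neg hy]
  have hφne : ∀ y, y ≠ x → φ y ≠ x := fun y hy h => by
    have := hφval y hy
    rw [h, ← hψω] at this
    exact y.2 (hinv.injective this).symm
  have hφφ : ∀ y, y ≠ x → φ (φ y) = y := fun y hy =>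
    Punctured.ext (by rw [hφval _ (hφne y hy), hφval y hy, hinv])
  have hφsph : ∀ y, dist y x = r → dist (φ y) x = r := by
    intro y hyr
    have hyx : y ≠ x := dist_pos.1 (hyr ▸ hr)
    rw [← hsph, hφval y hyx]
    have : ψ y.1 ∈ ψ '' {y | d.d y x.1 = ENNReal.ofReal r} := ⟨y.1, (hsph y).2 hyr, rfl⟩
    rw [hψsph] at this
    exact this
  have hratio : ∀ y z, y ≠ x → z ≠ x → ∃ l : ℝ, dist (φ y) (φ z) = l * dist y z ∧
      dist (φ z) x = l * dist y x ∧ dist (φ y) x = l * dist z x := by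
    intro y z hy hz
    have hxω := x.2
    have hyx : y.1 ≠ x.1 := fun h => hy (Punctured.ext h)
    have hzx : z.1 ≠ x.1 := fun h => hz (Punctured.ext h)
    obtain ⟨l, -, hl⟩ := hcrt d hd y.1 z.1 x.1 ω
      ⟨fun h => hzx h.2, fun h => z.2 h.2, fun h => hxω h.2, fun h => hxω h.2⟩
    rw [hψx, hψω, ← hφval y hy, ← hφval z hz] at hl
    simp only [crtVec, hfd, hfdω, hfdω', mul_one, one_mul, Prod.smul_mk, smul_eq_mul,
      Prod.mk.injEq] at hl
    exact ⟨l, hl⟩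
  have hy₀x : y₀ ≠ x := dist_pos.1 (hy₀ ▸ hr)
  have hrad : ∀ y, y ≠ x → dist (φ y) x = r ^ 2 / dist y x := by
    intro y hy
    obtain ⟨l, -, h1, h2⟩ := hratio y y₀ hy hy₀x
    rw [hφsph y₀ hy₀] at h1
    rw [h2, hy₀, eq_div_iff (dist_pos.2 hy).ne']
    linear_combination -r * h1
  have hmap : ∀ y z, y ≠ x → z ≠ x →
      dist (φ y) (φ z) = r ^ 2 * dist y z / (dist y x * dist z x) := by
    intro y z hy hz
    obtain ⟨l, h1, -, h2⟩ := hratio y z hy hz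
    have h3 := dist_pos.2 hy
    have h4 := dist_pos.2 hz
    rw [hrad y hy, div_eq_iff h3.ne'] at h2
    rw [h1, h2]
    field_simp
  refine ⟨φ, fun y hy => ⟨hφne y hy, hφφ y hy⟩, hmap, hrad, fun c hc hc0 t ht => ?_⟩
  have hcx : ∀ {t}, t ≠ 0 → c t ≠ x := fun {t} ht h => ht (hc.injective (h.trans hc0.symm))
  have hcdist : ∀ t, dist (c t) x = |t| := fun t => by rw [← hc0, dist_line hc, sub_zero]
  have hline : ∀ {t}, t ≠ 0 → ∃ t', φ (c t) = c t' ∧ |t'| = r ^ 2 / |t| := by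
    intro t ht
    have hσ := hψσ _ ((hcirc _).2 (h.isometry_iff.1 hc).isMetricPtolemyCircle)
      (Or.inr ⟨0, congrArg Punctured.val hc0⟩) (Or.inl rfl)
    have h1 : ψ (c t).1 ∈ insert ω (Set.range fun t => (c t).1) := by
      rw [← hσ]
      exact ⟨_, Or.inr ⟨t, rfl⟩, rfl⟩
    rw [← hφval _ (hcx ht)] at h1
    obtain ⟨t', h2⟩ := h1.resolve_left (φ (c t)).2
    have h3 : c t' = φ (c t) := Punctured.ext h2
    refine ⟨t', h3.symm, ?_⟩
    rw [← hcdist, h3, hrad _ (hcx ht), hcdist]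
  have hnofix : ∀ {t}, t ≠ 0 → φ (c t) ≠ c t := fun {t} ht h => by
    have := hφval _ (hcx ht)
    rw [h] at this
    exact hfix _ this.symm
  have hcirc_r : ∀ s, |s| = r → φ (c s) = c (-s) := by
    intro s hs
    have hs0 : s ≠ 0 := by
      rintro rfl
      rw [abs_zero] at hs
      exact hr.ne hs
    obtain ⟨s', h1, h2⟩ := hline hs0
    rw [hs, sq, mul_div_cancel_right₀ _ hr.ne', ← hs] at h2
    rcases abs_eq_abs.1 h2 with rfl | rfl
    · exact absurd h1 (hnofix hs0)
    · exact h1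
  obtain ⟨t', h1, h2⟩ := hline ht
  rw [h1]
  congr 1
  have habs : |r ^ 2 / t| = r ^ 2 / |t| := by rw [abs_div, abs_of_nonneg (sq_nonneg r)]
  rw [← habs] at h2
  rcases abs_eq_abs.1 h2 with h3 | h3
  · exfalso
    have key : ∀ s, |s| = r → |r ^ 2 / t + s| = r * |t - s| / |t| := by
      intro s hs
      have hs0 : s ≠ 0 := by
        rintro rfl
        rw [abs_zero] at hs
        exact hr.ne hs
      have h4 := hmap (c t) (c s) (hcx ht) (hcx hs0)
      rw [h1, hcirc_r s hs, dist_line hc, dist_line hc, hcdist, hcdist, hs, h3,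
        sub_neg_eq_add] at h4
      rw [h4]
      have := abs_pos.2 ht
      field_simp
    rcases lt_or_gt_of_ne ht with ht | ht
    · have h5 := key (-r) (by rw [abs_neg, abs_of_pos hr])
      have h6 : r ^ 2 / t < 0 := div_neg_of_pos_of_neg (by positivity) ht
      rw [abs_of_neg (by linarith), abs_of_neg ht, eq_div_iff (by linarith)] at h5
      have h7 : r ^ 2 / t * t = r ^ 2 := div_mul_cancel₀ _ ht.ne
      have h8 : |t - -r| = r - t := by
        refine mul_left_cancel₀ hr.ne' ?_
        linear_combination -h5 + h7
      rcases abs_cases (t - -r) with h9 | h9 <;> linarith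
    · have h5 := key r (abs_of_pos hr)
      have h6 : 0 < r ^ 2 / t := by positivity
      rw [abs_of_pos (by linarith), abs_of_pos ht, eq_div_iff (by linarith)] at h5
      have h7 : r ^ 2 / t * t = r ^ 2 := div_mul_cancel₀ _ ht.ne'
      have h8 : |t - r| = r + t := by
        refine mul_left_cancel₀ hr.ne' ?_
        linear_combination -h5 + h7
      rcases abs_cases (t - r) with h9 | h9 <;> linarith
  · exact h3

theorem isInversive_punctured (hcirc : ∀ σ, IsPtolemyCircle S σ ↔ IsMetricPtolemyCircle σ)
    (h : IsInvertedDist ω) (hpt : IsPtolemyStructure S) (hE : PropertyE S) (hI : PropertyI S)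
    (hd : d ∈ S.M) (hrem : d.rem = some ω)
    (hdist : ∀ x y : Punctured ω, dist x y = (d.d x.1 y.1).toReal) :
    IsInversive (Punctured ω) where
  ptolemy x y z u := by
    have hfd : ∀ y z : Punctured ω, dist y z = d.fd y.1 z.1 := fun y z => by
      rw [hdist, ExtMetric.fd_of_ne_rem hrem y.2 z.2]
    simp only [hfd]
    exact hpt.fd_mul_le hd _ _ _ _
  exists_inversion x _ hr hy := exists_punctured_inversion hcirc h hI hd hrem hdist x hr hy
  exists_line := by
    obtain ⟨σ, hσ⟩ := hE
    rw [hcirc] at hσ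
    by_cases hω : ω ∈ σ
    · obtain ⟨c, hc, -⟩ := hσ.exists_param hω
      obtain ⟨e, he, -⟩ := h.exists_isometry hc
      exact ⟨e, he⟩
    · obtain ⟨⟨a, ha⟩⟩ : Nonempty σ := ⟨hσ.1.some.symm ⟨1, by simp⟩⟩
      obtain ⟨c, hc, hrange⟩ := hσ.exists_param ha
      have haω : a ≠ ω := fun h => hω (h ▸ ha)
      have hcω : ∀ t, c t ≠ ω := fun t h => by
        have : c t ∈ σ \ {a} := hrange ▸ ⟨t, rfl⟩
        exact hω (h ▸ this.1)
      set x : Punctured ω := ⟨a, haω⟩ with hx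
      set e : ℝ → Punctured ω := fun t => ⟨c t, hcω t⟩ with he
      have hex : ∀ t, e t ≠ x := fun t h => hc.1 t (congrArg Punctured.val h)
      have hr : 0 < dist (e 0) x := dist_pos.2 (hex 0)
      set r := dist (e 0) x with hr'
      obtain ⟨φ, -, hφ, -⟩ := exists_punctured_inversion hcirc h hI hd hrem hdist x hr ⟨_, rfl⟩
      have hxω : 0 < dist x.1 ω := dist_pos.2 haω
      have hC : 0 < r ^ 2 * dist x.1 ω ^ 2 := by positivity
      have hdφ : ∀ s t, dist (φ (e s)) (φ (e t)) = r ^ 2 * dist x.1 ω ^ 2 * |s - t| := by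
        intro s t
        rw [hφ _ _ (hex s) (hex t), div_eq_iff
          (mul_pos (dist_pos.2 (hex s)) (dist_pos.2 (hex t))).ne']
        have h1 := h (e s) (e t)
        have h2 := h (e s) x
        have h3 := h (e t) x
        have h4 : dist (e s).1 (e t).1 = |s - t| * (dist (e s).1 x.1 * dist (e t).1 x.1) :=
          hc.2 s t
        rw [h1, h2, h3] at h4
        have h5 : 0 < dist (e s).1 ω * dist (e t).1 ω :=
          mul_pos (dist_pos.2 (e s).2) (dist_pos.2 (e t).2)
        refine mul_left_cancel₀ h5.ne' ?_
        linear_combination r ^ 2 * h4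
      refine ⟨fun t => φ (e (t / (r ^ 2 * dist x.1 ω ^ 2))), isometry_of_dist fun s t => ?_⟩
      rw [hdφ, ← sub_div, abs_div, abs_of_pos hC, mul_div_cancel₀ _ hC.ne']

end Punctured

section Fibration

variable {X : Type*} {S : MobiusStructure X} {d : ExtMetric X} {ω : X}

theorem PropertyE.exists_ne (hE : PropertyE S) (ω : X) : ∃ o : X, o ≠ ω := by
  let _ : TopologicalSpace X := mobiusTop S
  obtain ⟨σ, ⟨h⟩, -⟩ := hE
  set p : Metric.sphere (0 : ℂ) 1 := ⟨1, by simp⟩ with hp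
  set q : Metric.sphere (0 : ℂ) 1 := ⟨-1, by simp⟩ with hq
  by_contra! hall
  have h1 : h.symm p = h.symm q := Subtype.ext ((hall _).trans (hall _).symm)
  have h2 := congrArg Subtype.val (h.symm.injective h1)
  norm_num [hp, hq] at h2

section

variable [MetricSpace X] [MetricSpace (Punctured ω)] [CompactSpace X]

theorem isPtolemyLine_iff (hcirc : ∀ σ, IsPtolemyCircle S σ ↔ IsMetricPtolemyCircle σ)
    (h : IsInvertedDist ω) {l : Set X} : IsPtolemyLine S ω l ↔
      ∃ c : ℝ → Punctured ω, Isometry c ∧ l = Set.range fun t => (c t).1 := by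
  constructor
  · rintro ⟨σ, hσ, hω, rfl⟩
    obtain ⟨c, hc, hrange⟩ := ((hcirc σ).1 hσ).exists_param hω
    obtain ⟨e, he, hec⟩ := h.exists_isometry hc
    exact ⟨e, he, by rw [← hrange]; simp only [hec]⟩
  · rintro ⟨c, hc, rfl⟩
    refine ⟨_, (hcirc _).2 (h.isometry_iff.1 hc).isMetricPtolemyCircle, Or.inl rfl, ?_⟩
    rw [Set.insert_sdiff_self_of_notMem]
    rintro ⟨t, ht⟩
    exact (c t).2 ht

theorem mem_mobiusFiber_iff (hcirc : ∀ σ, IsPtolemyCircle S σ ↔ IsMetricPtolemyCircle σ)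
    (h : IsInvertedDist ω) (hrem : d.rem = some ω)
    (hdist : ∀ x y : Punctured ω, dist x y = (d.d x.1 y.1).toReal) (x y : Punctured ω) :
    y.1 ∈ mobiusFiber S d ω x.1 ↔ SameFiber y x := by
  classical
  constructor
  · rintro ⟨-, hb⟩ c hc
    have h1 := hb (Set.range fun t => (c t).1)
      (fun z => if hz : z = ω then 0 else busemann c ⟨z, hz⟩)
      ⟨(isPtolemyLine_iff hcirc h).2 ⟨c, hc, rfl⟩, fun t => (c t).1, ⟨rfl, fun s t => ?_⟩, 0,
        fun z hz => ?_⟩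
    · simpa only [dif_neg x.2, dif_neg y.2] using h1
    · rw [← dist_line hc, hdist, ENNReal.ofReal_toReal (ExtMetric.d_ne_top hrem (c s).2 (c t).2)]
    · simp only [dif_neg hz, add_zero]
      simpa only [hdist] using tendsto_busemann hc ⟨z, hz⟩
  · refine fun hyx => ⟨y.2, ?_⟩
    rintro l b ⟨hl, c, ⟨hrange, hunit⟩, C, hb⟩
    have hcω : ∀ t, c t ≠ ω := by
      intro t
      obtain ⟨e, -, rfl⟩ := (isPtolemyLine_iff hcirc h).1 hl
      obtain ⟨s, hs⟩ : c t ∈ Set.range fun t => (e t).1 := hrange ▸ ⟨t, rfl⟩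
      exact hs ▸ (e s).2
    have hc : Isometry fun t => (⟨c t, hcω t⟩ : Punctured ω) := isometry_of_dist fun s t => by
      rw [hdist, hunit, ENNReal.toReal_ofReal (abs_nonneg _)]
    have hval : ∀ z : Punctured ω, busemann (fun t => (⟨c t, hcω t⟩ : Punctured ω)) z = b z.1 + C :=
      fun z => busemann_eq hc (by simpa only [hdist] using hb z.1 z.2)
    have h1 := hyx _ hc
    rw [hval, hval] at h1
    exact add_right_cancel h1

end

/-- The canonical fibration of `X_ω`, realized as a map onto a Euclidean space. -/
theorem exists_canonical_fibration (hpt : IsPtolemyStructure S) (hcomp : MobiusCompact S)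
    (hE : PropertyE S) (hI : PropertyI S) (hd : d ∈ S.M) (hrem : d.rem = some ω) :
    ∃ k : ℕ, 1 ≤ k ∧ ∃ f : Punctured ω → EuclideanSpace ℝ (Fin k), Function.Surjective f ∧
      (∀ x y : Punctured ω, y.1 ∈ mobiusFiber S d ω x.1 ↔ f y = f x) ∧
      (∀ x y : Punctured ω, dist (f x) (f y) ≤ (d.d x.1 y.1).toReal) ∧
      (∀ x y : Punctured ω, ∃ y' : Punctured ω, f y' = f y ∧
        (d.d x.1 y'.1).toReal = dist (f x) (f y)) ∧
      ∀ l, IsPtolemyLine S ω l → ∀ x y : Punctured ω, x.1 ∈ l → y.1 ∈ l →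
        dist (f x) (f y) = (d.d x.1 y.1).toReal := by
  obtain ⟨o, ho⟩ := hE.exists_ne ω
  obtain ⟨_, hS, hinv⟩ := exists_isCompatibleMetric hpt hd hrem ho
  let _ : MetricSpace (Punctured ω) := d.puncturedMetric hrem
  have hdist : ∀ x y : Punctured ω, dist x y = (d.d x.1 y.1).toReal := fun _ _ => rfl
  have h : IsInvertedDist ω := fun x y => hinv x.1 y.1 x.2 y.2
  have hcirc : ∀ σ, IsPtolemyCircle S σ ↔ IsMetricPtolemyCircle σ := fun σ =>
    isPtolemyCircle_iff hS hcomp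
  have : CompactSpace X := by
    have h1 : @CompactSpace X (mobiusTop S) := hcomp
    rwa [mobiusTop_eq hS hcomp] at h1
  have := h.properSpace
  have hY := isInversive_punctured hcirc h hpt hE hI hd hrem hdist
  obtain ⟨k, hk, f, hf, hfib, hline⟩ := hY.exists_map_euclideanSpace
  refine ⟨k, hk, f, hf, fun x y => ?_, fun x y => ?_, fun x y => ?_, ?_⟩
  · rw [mem_mobiusFiber_iff hcirc h hrem hdist, hfib]
  · obtain ⟨e, he, rfl, t, -, ht⟩ := hY.exists_line_to_fiber x y
    rw [← (hfib _ _).2 ht, hline e he, ← hdist]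
    exact abs_sub_le_dist_of_sameFiber he (fun _ _ => rfl) ht.symm
  · obtain ⟨e, he, rfl, t, -, ht⟩ := hY.exists_line_to_fiber x y
    exact ⟨e t, (hfib _ _).2 ht, by rw [← (hfib _ _).2 ht, hline e he, ← hdist, dist_line he]⟩
  · intro l hl x y hx hy
    obtain ⟨c, hc, rfl⟩ := (isPtolemyLine_iff hcirc h).1 hl
    obtain ⟨s, hs⟩ := hx
    obtain ⟨t, ht⟩ := hy
    rw [← Punctured.ext hs, ← Punctured.ext ht, hline c hc, ← hdist, dist_line hc]

end Fibration

end FibrationProof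

/-- Propositions 6.21 and 6.23 of the paper.  Let `X` be a compact
Ptolemy space with properties (E) and (I), `ω ∈ X`, and define the distance between
fibers of `π_ω` by `dist(F,F') = inf{d(x,x') : x ∈ F, x' ∈ F'}`.  Then:
(1) this distance is a metric on the base `B_ω`, and equals `d(x,x')` whenever
`x ∈ F`, `x' ∈ F'` lie on a common Ptolemy line;
(2) `π_ω` is a 1-Lipschitz submetry;
(3) `B_ω` is isometric to a Euclidean space `ℝᵏ` for some `k ≥ 1`. -/
theorem stmt_12 {X : Type*} (S : MobiusStructure X)
    (hpt : IsPtolemyStructure S) (hcomp : MobiusCompact S)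
    (hE : PropertyE S) (hI : PropertyI S)
    (ω : X) (d : ExtMetric X) (hd : d ∈ S.M) (hrem : d.rem = some ω) :
    -- (1) `fiberDist` is a metric on `B_ω` ...
    ((∀ F ∈ mobiusBase S d ω, ∀ F' ∈ mobiusBase S d ω,
        0 ≤ fiberDist d F F' ∧ fiberDist d F F' = fiberDist d F' F ∧
        (fiberDist d F F' = 0 ↔ F = F')) ∧
      (∀ F ∈ mobiusBase S d ω, ∀ F' ∈ mobiusBase S d ω, ∀ F'' ∈ mobiusBase S d ω,
        fiberDist d F F'' ≤ fiberDist d F F' + fiberDist d F' F'') ∧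
      -- ... which equals `d(x,x')` whenever `x ∈ F`, `x' ∈ F'` lie on a common
      -- Ptolemy line
      (∀ F ∈ mobiusBase S d ω, ∀ F' ∈ mobiusBase S d ω, ∀ x ∈ F, ∀ x' ∈ F',
        (∃ l : Set X, IsPtolemyLine S ω l ∧ x ∈ l ∧ x' ∈ l) →
        fiberDist d F F' = (d.d x x').toReal)) ∧
    -- (2) `π_ω` is a 1-Lipschitz submetry
    ((∀ x x' : X, x ≠ ω → x' ≠ ω →
        fiberDist d (mobiusFiber S d ω x) (mobiusFiber S d ω x') ≤ (d.d x x').toReal) ∧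
      (∀ x : X, x ≠ ω → ∀ r : ℝ, 0 < r →
        (fun y => mobiusFiber S d ω y) '' {y | y ≠ ω ∧ (d.d x y).toReal < r} =
          {F | F ∈ mobiusBase S d ω ∧ fiberDist d (mobiusFiber S d ω x) F < r})) ∧
    -- (3) `B_ω` is isometric to a Euclidean space `ℝᵏ`, `k ≥ 1`
    (∃ k : ℕ, 1 ≤ k ∧
      ∃ f : {F : Set X // F ∈ mobiusBase S d ω} → EuclideanSpace ℝ (Fin k),
        Function.Bijective f ∧
        ∀ F F' : {F : Set X // F ∈ mobiusBase S d ω},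
          dist (f F) (f F') = fiberDist d F.1 F'.1) := by
  obtain ⟨k, hk, f, hf, hfib, hle, hlift, hline⟩ :=
    exists_canonical_fibration hpt hcomp hE hI hd hrem
  have hfiber : ∀ x : Punctured ω, mobiusFiber S d ω x.1 ∈ mobiusBase S d ω := fun x =>
    ⟨x.1, x.2, rfl⟩
  have hbase : ∀ F ∈ mobiusBase S d ω, ∃ x : Punctured ω, F = mobiusFiber S d ω x.1 := by
    rintro F ⟨x, hx, rfl⟩
    exact ⟨⟨x, hx⟩, rfl⟩
  have hlift_mem : ∀ F ∈ mobiusBase S d ω, ∀ x ∈ F, ∃ y : Punctured ω, y.1 = x := by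
    rintro F ⟨x, -, rfl⟩ y hy
    exact ⟨⟨y, hy.1⟩, rfl⟩
  have hself : ∀ x : Punctured ω, x.1 ∈ mobiusFiber S d ω x.1 := fun x => (hfib x x).2 rfl
  have heq : ∀ x y : Punctured ω,
      mobiusFiber S d ω x.1 = mobiusFiber S d ω y.1 ↔ f x = f y := by
    refine fun x y => ⟨fun h => (hfib y x).1 (h ▸ hself x), fun h => Set.ext fun z => ?_⟩
    by_cases hz : z = ω
    · exact iff_of_false (fun h => h.1 hz) (fun h => h.1 hz)
    · have h1 := hfib x ⟨z, hz⟩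
      have h2 := hfib y ⟨z, hz⟩
      rw [h] at h1
      exact h1.trans h2.symm
  have hdist : ∀ x y : Punctured ω,
      fiberDist d (mobiusFiber S d ω x.1) (mobiusFiber S d ω y.1) = dist (f x) (f y) := by
    intro x y
    refine IsLeast.csInf_eq ⟨?_, ?_⟩
    · obtain ⟨y', hy', h⟩ := hlift x y
      exact ⟨x.1, hself x, y'.1, (hfib y y').2 hy', h.symm⟩
    · rintro r ⟨p, hp, q, hq, rfl⟩
      obtain ⟨p, rfl⟩ := hlift_mem _ (hfiber x) p hp
      obtain ⟨q, rfl⟩ := hlift_mem _ (hfiber y) q hq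
      rw [← (hfib x p).1 hp, ← (hfib y q).1 hq]
      exact hle p q
  refine ⟨⟨?_, ?_, ?_⟩, ⟨?_, ?_⟩, k, hk, ?_⟩
  · intro F hF F' hF'
    obtain ⟨x, rfl⟩ := hbase F hF
    obtain ⟨y, rfl⟩ := hbase F' hF'
    rw [hdist, hdist, heq]
    exact ⟨dist_nonneg, dist_comm _ _, dist_eq_zero⟩
  · intro F hF F' hF' F'' hF''
    obtain ⟨x, rfl⟩ := hbase F hF
    obtain ⟨y, rfl⟩ := hbase F' hF'
    obtain ⟨z, rfl⟩ := hbase F'' hF''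
    rw [hdist, hdist, hdist]
    exact dist_triangle _ _ _
  · rintro F hF F' hF' x hx x' hx' ⟨l, hl, hxl, hxl'⟩
    obtain ⟨p, rfl⟩ := hlift_mem F hF x hx
    obtain ⟨q, rfl⟩ := hlift_mem F' hF' x' hx'
    obtain ⟨y, rfl⟩ := hbase F hF
    obtain ⟨z, rfl⟩ := hbase F' hF'
    rw [hdist, ← (hfib y p).1 hx, ← (hfib z q).1 hx']
    exact hline l hl p q hxl hxl'
  · intro x x' hx hx'
    exact (hdist ⟨x, hx⟩ ⟨x', hx'⟩).trans_le (hle ⟨x, hx⟩ ⟨x', hx'⟩)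
  · intro x hx r _
    ext F
    constructor
    · rintro ⟨y, ⟨hy, hr⟩, rfl⟩
      exact ⟨hfiber ⟨y, hy⟩, ((hdist ⟨x, hx⟩ ⟨y, hy⟩).trans_le (hle ⟨x, hx⟩ ⟨y, hy⟩)).trans_lt hr⟩
    · rintro ⟨hF, hr⟩
      obtain ⟨y, rfl⟩ := hbase F hF
      obtain ⟨y', hy', h⟩ := hlift ⟨x, hx⟩ y
      refine ⟨y'.1, ⟨y'.2, ?_⟩, (heq y' y).2 hy'⟩
      rw [h, ← hdist]
      exact hr
  · choose p hp using fun F : {F : Set X // F ∈ mobiusBase S d ω} => hbase F.1 F.2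
    refine ⟨fun F => f (p F), ⟨fun F F' h => ?_, fun v => ?_⟩, fun F F' => ?_⟩
    · exact Subtype.ext (((hp F).trans ((heq _ _).2 h)).trans (hp F').symm)
    · obtain ⟨x, rfl⟩ := hf v
      exact ⟨⟨_, hfiber x⟩, ((heq _ _).1 (hp ⟨_, hfiber x⟩)).symm⟩
    · rw [← hdist, ← hp, ← hp]

end Mobius
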